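/- arXiv:1809.00283 — 2 statements merged into one kernel-verified Lean document; each statement's English description precedes it below -/
import Mathlib

section
/- Let G₁ and G₂ be nontrivial, finitely generated, freely indecomposable, perfectly-Hopfian groups with G₁ non-cyclic. Then the free product G₁ ∗ G₂ is perfectly-Hopfian. -/
/-- A group is perfectly-Hopfian if every endomorphism with normal image and
perfect quotient is an automorphism. -/
def PerfectlyHopfian (G : Type*) [Group G] : Prop :=
  ∀ φ : G →* G, ∀ hn : φ.range.Normal,
    (haveI := hn; commutator (G ⧸ φ.range) = ⊤) → Function.Bijective φ

/-- A group is freely indecomposable if whenever it is isomorphic to a free product,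
one of the two factors is trivial. -/
def FreelyIndecomposable (G : Type*) [Group G] : Prop :=
  ∀ (A B : Type) [Group A] [Group B],
    Nonempty (G ≃* Monoid.Coprod A B) → Subsingleton A ∨ Subsingleton B

/-- `s g` records on which side of a base edge the nontrivial element `g` starts and `l` is a
length function; reduced products start where the first factor starts. -/
structure IsSided {G : Type*} [Group G] (s : G → Bool) (l : G → ℕ) : Prop where
  mul_ne_one : ∀ p q, p ≠ 1 → q ≠ 1 → s p⁻¹ ≠ s q → p * q ≠ 1
  side_mul : ∀ p q, p ≠ 1 → q ≠ 1 → s p⁻¹ ≠ s q → s (p * q) = s p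
  length_mul : ∀ p q, p ≠ 1 → q ≠ 1 → s p⁻¹ ≠ s q → l (p * q) = l p + l q
  length_pos : ∀ p, p ≠ 1 → 0 < l p

namespace IsSided

variable {G : Type*} [Group G] {s : G → Bool} {l : G → ℕ}

/-- A nontrivial element of `H` that is no reduced product of two nontrivial elements of `H`. -/
structure IsPrim (s : G → Bool) (H : Subgroup G) (k : G) : Prop where
  mem : k ∈ H
  ne_one : k ≠ 1
  side_eq : ∀ p q, p ∈ H → p ≠ 1 → q ≠ 1 → k = p * q → s p⁻¹ = s q

variable {H : Subgroup G}

lemma IsPrim.inv {k : G} (hk : IsPrim s H k) : IsPrim s H k⁻¹ where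
  mem := H.inv_mem hk.mem
  ne_one := inv_ne_one.2 hk.ne_one
  side_eq p q hp hp1 hq1 h := by
    have h' : k = q⁻¹ * p⁻¹ := by rw [← mul_inv_rev, ← h, inv_inv]
    have hq : q ∈ H := by
      have : q = p⁻¹ * k⁻¹ := by rw [h]; group
      rw [this]
      exact H.mul_mem (H.inv_mem hp) (H.inv_mem hk.mem)
    have := hk.side_eq q⁻¹ p⁻¹ (H.inv_mem hq) (inv_ne_one.2 hq1) (inv_ne_one.2 hp1) h'
    rw [inv_inv] at this
    exact this.symm

lemma IsPrim.side_mul {x y : G} (hx : IsPrim s H x) (hy : IsPrim s H y) (hxy : x * y ≠ 1) :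
    s (x * y) = s x := by
  have := hy.side_eq x⁻¹ (x * y) (H.inv_mem hx.mem) (inv_ne_one.2 hx.ne_one) hxy (by group)
  rw [inv_inv] at this
  exact this.symm

lemma IsPrim.side_mul_inv {x y : G} (hx : IsPrim s H x) (hy : IsPrim s H y) (hxy : x * y ≠ 1) :
    s (x * y)⁻¹ = s y⁻¹ := by
  rw [mul_inv_rev]
  exact hy.inv.side_mul hx.inv (by rwa [← mul_inv_rev, inv_ne_one])

lemma IsPrim.mul {x y : G} (hx : IsPrim s H x) (hy : IsPrim s H y)
    (hxy : x * y ≠ 1) (h : s x⁻¹ = s y) : IsPrim s H (x * y) where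
  mem := H.mul_mem hx.mem hy.mem
  ne_one := hxy
  side_eq p q hp hp1 hq1 e := by
    by_contra hne
    by_cases hu : x⁻¹ * p = 1
    · have hpx : p = x := by rw [inv_mul_eq_one] at hu; exact hu.symm
      subst hpx
      have : y = q := mul_left_cancel e
      subst this
      exact hne h
    · have h1 := hx.inv.side_eq (x⁻¹ * p) p⁻¹ (H.mul_mem (H.inv_mem hx.mem) hp) hu
        (inv_ne_one.2 hp1) (by group)
      have h2 := hy.side_eq (x⁻¹ * p) q (H.mul_mem (H.inv_mem hx.mem) hp) hu hq1
        (by rw [mul_assoc, ← e]; group)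
      exact hne (h1.symm.trans h2)

/-- The elements of `H` that are trivial or prime with both ends on side `b`. -/
def primSubgroup (_hs : IsSided s l) (H : Subgroup G) (b : Bool) : Subgroup G where
  carrier := {k | k = 1 ∨ IsPrim s H k ∧ s k = b ∧ s k⁻¹ = b}
  one_mem' := Or.inl rfl
  inv_mem' := by
    rintro k (rfl | ⟨h, h1, h2⟩)
    · exact Or.inl inv_one
    · exact Or.inr ⟨h.inv, h2, by rwa [inv_inv]⟩
  mul_mem' := by
    rintro x y (rfl | ⟨hx, hx1, hx2⟩) hy
    · rwa [one_mul]
    · rcases hy with rfl | ⟨hy, hy1, hy2⟩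
      · rw [mul_one]; exact Or.inr ⟨hx, hx1, hx2⟩
      · by_cases h : x * y = 1
        · exact Or.inl h
        · exact Or.inr ⟨hx.mul hy h (hx2.trans hy1.symm),
            (hx.side_mul hy h).trans hx1, (hx.side_mul_inv hy h).trans hy2⟩

lemma mem_primSubgroup {hs : IsSided s l} {b : Bool} {k : G} :
    k ∈ hs.primSubgroup H b ↔ k = 1 ∨ IsPrim s H k ∧ s k = b ∧ s k⁻¹ = b := Iff.rfl

lemma primSubgroup_le (hs : IsSided s l) (b : Bool) : hs.primSubgroup H b ≤ H := by
  rintro k (rfl | ⟨h, -, -⟩)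
  · exact H.one_mem
  · exact h.mem

/-- A subgroup is generated by its prime elements. -/
lemma le_of_isPrim_mem (hs : IsSided s l) {K : Subgroup G}
    (hK : ∀ k, IsPrim s H k → k ∈ K) : H ≤ K := by
  intro h
  induction hn : l h using Nat.strong_induction_on generalizing h with
  | _ n ih =>
    intro hh
    by_cases h1 : h = 1
    · rw [h1]; exact K.one_mem
    by_cases hp : IsPrim s H h
    · exact hK h hp
    have : ∃ p q, p ∈ H ∧ p ≠ 1 ∧ q ≠ 1 ∧ h = p * q ∧ s p⁻¹ ≠ s q := by
      by_contra hcon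
      push Not at hcon
      exact hp ⟨hh, h1, hcon⟩
    obtain ⟨p, q, hpH, hp1, hq1, rfl, hne⟩ := this
    have hl := hs.length_mul p q hp1 hq1 hne
    have := hs.length_pos p hp1
    have := hs.length_pos q hq1
    have hqH : q ∈ H := (Subgroup.mul_mem_cancel_left H hpH).1 hh
    exact K.mul_mem (ih (l p) (by omega) rfl hpH) (ih (l q) (by omega) rfl hqH)

lemma lift_primSubgroup_neWord (hs : IsSided s l) {i j : Bool}
    (w : Monoid.CoprodI.NeWord (fun b => hs.primSubgroup H b) i j) :
    Monoid.CoprodI.lift (fun b => (hs.primSubgroup H b).subtype) w.prod ≠ 1 ∧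
      s (Monoid.CoprodI.lift (fun b => (hs.primSubgroup H b).subtype) w.prod) = i ∧
      s (Monoid.CoprodI.lift (fun b => (hs.primSubgroup H b).subtype) w.prod)⁻¹ = j := by
  induction w with
  | singleton x hx =>
    rw [Monoid.CoprodI.NeWord.prod_singleton, Monoid.CoprodI.lift_of]
    rcases x.2 with h | ⟨h, h1, h2⟩
    · exact absurd (Subtype.ext h) hx
    · exact ⟨h.ne_one, h1, h2⟩
  | append w₁ hne w₂ ih₁ ih₂ =>
    rw [Monoid.CoprodI.NeWord.append_prod, map_mul]
    obtain ⟨a1, a2, a3⟩ := ih₁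
    obtain ⟨b1, b2, b3⟩ := ih₂
    refine ⟨hs.mul_ne_one _ _ a1 b1 (by rw [a3, b2]; exact hne),
      (hs.side_mul _ _ a1 b1 (by rw [a3, b2]; exact hne)).trans a2, ?_⟩
    rw [mul_inv_rev, hs.side_mul _ _ (inv_ne_one.2 b1) (inv_ne_one.2 a1)
      (by rw [a3, inv_inv, b2]; exact hne.symm), b3]

end IsSided

namespace Monoid.CoprodI

variable {ι : Type*} {M : ι → Type*} [∀ i, Group (M i)]

/-- A nontrivial element is the product of a nonempty reduced word. -/
lemma exists_neWord {g : CoprodI M} (hg : g ≠ 1) :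
    ∃ (i j : ι) (w : NeWord M i j), w.prod = g := by
  classical
  obtain ⟨i, j, w, hw⟩ := NeWord.of_word (Word.equiv g) (by
    intro h
    apply hg
    have := Word.equiv.symm_apply_apply g
    rw [h] at this
    rw [← this]
    exact Word.prod_empty)
  refine ⟨i, j, w, ?_⟩
  rw [NeWord.prod, hw]
  exact Word.equiv.symm_apply_apply g

lemma injective_of_neWord {N : Type*} [Group N] (f : CoprodI M →* N)
    (h : ∀ (i j : ι) (w : NeWord M i j), f w.prod ≠ 1) : Function.Injective f := by
  rw [injective_iff_map_eq_one]
  intro g hg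
  by_contra hne
  obtain ⟨i, j, w, rfl⟩ := exists_neWord hne
  exact h i j w hg

end Monoid.CoprodI

namespace IsSided
open Monoid.CoprodI
variable {G : Type} [Group G] {s : G → Bool} {l : G → ℕ} {H : Subgroup G}

lemma pow_ne_one (hs : IsSided s l) {t : G} (ht1 : t ≠ 1) (ht : s t ≠ s t⁻¹) (n : ℕ) :
    t ^ (n + 1) ≠ 1 ∧ s (t ^ (n + 1)) = s t := by
  induction n with
  | zero => simp [ht1]
  | succ n ih =>
    rw [pow_succ' t (n + 1)]
    have h : s t⁻¹ ≠ s (t ^ (n + 1)) := by rw [ih.2]; exact ht.symm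
    exact ⟨hs.mul_ne_one _ _ ht1 ih.1 h, hs.side_mul _ _ ht1 ih.1 h⟩

lemma zpow_injective (hs : IsSided s l) {t : G} (ht1 : t ≠ 1) (ht : s t ≠ s t⁻¹) :
    Function.Injective (zpowersHom G t) := by
  have : ¬ IsOfFinOrder t := by
    rw [isOfFinOrder_iff_pow_eq_one]
    rintro ⟨n, hn, h⟩
    obtain ⟨m, rfl⟩ := Nat.exists_eq_succ_of_ne_zero hn.ne'
    exact (hs.pow_ne_one ht1 ht m).1 h
  intro a b hab
  rw [zpowersHom_apply, zpowersHom_apply] at hab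
  exact injective_zpow_iff_not_isOfFinOrder.2 this hab

/-- The two vertex groups of the splitting of `H` along an edge whose ends are equivalent. -/
def hnnFactors (X : Subgroup G) : Bool → GrpCat.{0}
  | true => GrpCat.of X
  | false => GrpCat.of (Multiplicative ℤ)

/-- The natural map from the free product of `X` and an infinite cyclic group. -/
noncomputable def hnnHom (X : Subgroup G) (t : G) (b : Bool) : hnnFactors X b →* G :=
  match b with
  | true => X.subtype
  | false => zpowersHom G t

lemma hnnHom_injective (hs : IsSided s l) {t : G} (ht : IsPrim s H t) (ht1 : s t = true)
    (ht2 : s t⁻¹ = false) (hX : ∃ x ∈ hs.primSubgroup H true, x ≠ 1) :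
    Function.Injective (lift (hnnHom (hs.primSubgroup H true) t)) := by
  have tne := ht.ne_one
  let SX : Set G := {g | g ≠ 1 ∧ s g = true ∧ t⁻¹ * g ≠ 1 ∧ s (t⁻¹ * g) = false}
  let Sp : Set G := {g | g = t ∨ t⁻¹ * g ≠ 1 ∧ s (t⁻¹ * g) = true}
  let Sm : Set G := {g | g ≠ 1 ∧ s g = false}
  have tmul : ∀ g, g ≠ 1 → s g = true → t * g ≠ 1 ∧ s (t * g) = true := fun g hg hg' =>
    ⟨hs.mul_ne_one _ _ tne hg (by simp [ht2, hg']),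
      (hs.side_mul _ _ tne hg (by simp [ht2, hg'])).trans ht1⟩
  have hSp : ∀ g ∈ Sp, g ≠ 1 ∧ s g = true := by
    rintro g (rfl | ⟨h1, h2⟩)
    · exact ⟨tne, ht1⟩
    · simpa using tmul _ h1 h2
  have tSp : ∀ g, g ≠ 1 → s g = true → t * g ∈ Sp := fun g h1 h2 =>
    Or.inr (by rw [inv_mul_cancel_left]; exact ⟨h1, h2⟩)
  have tinv : ∀ g, g ∈ Sm → t⁻¹ * g ∈ Sm := fun g hg =>
    ⟨hs.mul_ne_one _ _ (inv_ne_one.2 tne) hg.1 (by simp [ht1, hg.2]),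
      (hs.side_mul _ _ (inv_ne_one.2 tne) hg.1 (by simp [ht1, hg.2])).trans ht2⟩
  have hdisj : ∀ g, g ∈ SX → g ∈ Sp ∪ Sm → False := by
    rintro g ⟨h1, h2, h3, h4⟩ ((rfl | ⟨h5, h6⟩) | ⟨h5, h6⟩)
    · simp at h3
    · simp_all
    · simp_all
  -- primality facts for `x ∈ X`
  have key : ∀ x ∈ hs.primSubgroup H true, x ≠ 1 → ∀ g, g ∈ Sp ∪ Sm → x * g ∈ SX := by
    rintro x hx hx1 g hg
    obtain ⟨hxp, hx2, hx3⟩ := (mem_primSubgroup.1 hx).resolve_left hx1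
    have htx1 : t⁻¹ * x ≠ 1 := by
      intro h
      rw [inv_mul_eq_one] at h
      subst h
      simp_all
    have htx : IsPrim s H (t⁻¹ * x) := ht.inv.mul hxp htx1 (by simp [ht1, hx2])
    have htxs : s (t⁻¹ * x) = false := (ht.inv.side_mul hxp htx1).trans ht2
    have htxe : s (t⁻¹ * x)⁻¹ = true := (ht.inv.side_mul_inv hxp htx1).trans hx3
    have hxt1 : x * t ≠ 1 := by
      intro h
      have : x = t⁻¹ := eq_inv_of_mul_eq_one_left h
      subst this
      simp_all
    have hxt : IsPrim s H (x * t) := hxp.mul ht hxt1 (by simp [ht1, hx3])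
    have hxts : s (x * t) = true := (hxp.side_mul ht hxt1).trans hx2
    have hxte : s (x * t)⁻¹ = false := (hxp.side_mul_inv ht hxt1).trans ht2
    have hc1 : t⁻¹ * x * t ≠ 1 := by
      intro h
      apply hx1
      have : x = t * (t⁻¹ * x * t) * t⁻¹ := by group
      rw [this, h]; group
    have hcs : s (t⁻¹ * x * t) = false := (htx.side_mul ht hc1).trans htxs
    have hce : s (t⁻¹ * x * t)⁻¹ = false := (htx.side_mul_inv ht hc1).trans ht2
    rcases hg with (rfl | ⟨h1, h2⟩) | ⟨h1, h2⟩
    · exact ⟨hxt1, hxts, by rwa [← mul_assoc], by rwa [← mul_assoc]⟩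
    · have e1 : x * g = (x * t) * (t⁻¹ * g) := by group
      have e2 : t⁻¹ * (x * g) = (t⁻¹ * x * t) * (t⁻¹ * g) := by group
      refine ⟨?_, ?_, ?_, ?_⟩
      · rw [e1]; exact hs.mul_ne_one _ _ hxt1 h1 (by rw [hxte, h2]; decide)
      · rw [e1, hs.side_mul _ _ hxt1 h1 (by rw [hxte, h2]; decide), hxts]
      · rw [e2]; exact hs.mul_ne_one _ _ hc1 h1 (by rw [hce, h2]; decide)
      · rw [e2, hs.side_mul _ _ hc1 h1 (by rw [hce, h2]; decide), hcs]
    · refine ⟨?_, ?_, ?_, ?_⟩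
      · exact hs.mul_ne_one _ _ hx1 h1 (by simp [hx3, h2])
      · rw [hs.side_mul _ _ hx1 h1 (by simp [hx3, h2]), hx2]
      · rw [← mul_assoc]; exact hs.mul_ne_one _ _ htx1 h1 (by rw [htxe, h2]; decide)
      · rw [← mul_assoc, hs.side_mul _ _ htx1 h1 (by rw [htxe, h2]; decide), htxs]
  have tpow : ∀ n : ℕ, ∀ g ∈ SX, t ^ (n + 1) * g ∈ Sp ∧ t⁻¹ ^ (n + 1) * g ∈ Sm := by
    intro n g hg
    induction n with
    | zero => simpa using ⟨tSp g hg.1 hg.2.1, hg.2.2.1, hg.2.2.2⟩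
    | succ n ih =>
      rw [pow_succ' t (n + 1), pow_succ' t⁻¹ (n + 1), mul_assoc, mul_assoc]
      exact ⟨tSp _ (hSp _ ih.1).1 (hSp _ ih.1).2, tinv _ ih.2⟩
  have tz : ∀ n : ℤ, n ≠ 0 → ∀ g ∈ SX, t ^ n * g ∈ Sp ∪ Sm := by
    intro n hn g hg
    obtain ⟨m, rfl | rfl⟩ := n.eq_nat_or_neg
    · obtain ⟨k, rfl⟩ := Nat.exists_eq_succ_of_ne_zero (n := m) (by simpa using hn)
      rw [zpow_natCast]; exact Or.inl (tpow k g hg).1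
    · obtain ⟨k, rfl⟩ := Nat.exists_eq_succ_of_ne_zero (n := m) (by simpa using hn)
      rw [zpow_neg, zpow_natCast, ← inv_pow]; exact Or.inr (tpow k g hg).2
  obtain ⟨x, hx, hx1⟩ := hX
  refine lift_injective_of_ping_pong (hnnHom (hs.primSubgroup H true) t)
    (Or.inr ⟨false, ?_⟩) (fun b => match b with | true => SX | false => Sp ∪ Sm) ?_ ?_ ?_
  · have : Infinite (hnnFactors (hs.primSubgroup H true) false) :=
      inferInstanceAs (Infinite (Multiplicative ℤ))
    exact (Cardinal.natCast_lt_aleph0 (n := 3)).le.trans (Cardinal.aleph0_le_mk _)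
  · rintro (_ | _)
    · exact ⟨t, Or.inl (Or.inl rfl)⟩
    · exact ⟨x * t, key x hx hx1 t (Or.inl (Or.inl rfl))⟩
  · rintro (_ | _) (_ | _) hij
    · exact absurd rfl hij
    · exact Set.disjoint_left.2 fun g h1 h2 => hdisj g h2 h1
    · exact Set.disjoint_left.2 fun g h1 h2 => hdisj g h1 h2
    · exact absurd rfl hij
  · rintro (_ | _) (_ | _) hij
    · exact absurd rfl hij
    · rintro h hh _ ⟨g, hg, rfl⟩
      exact tz (Multiplicative.toAdd h) (fun h0 => hh (Multiplicative.toAdd.injective h0)) g hg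
    · rintro h hh _ ⟨g, hg, rfl⟩
      exact key h.1 h.2 (fun h0 => hh (Subtype.ext h0)) g hg
    · exact absurd rfl hij

lemma le_of_primSubgroup_le_of_mem (hs : IsSided s l) {t : G} (ht : IsPrim s H t)
    (ht1 : s t = true) (ht2 : s t⁻¹ = false) {K : Subgroup G}
    (hX : hs.primSubgroup H true ≤ K) (htK : t ∈ K) : H ≤ K := by
  have h12 : ∀ k, IsPrim s H k → s k = true → s k⁻¹ = false → k ∈ K := by
    intro k hk h1 h2
    have : k * t⁻¹ ∈ K := by
      apply hX
      by_cases h : k * t⁻¹ = 1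
      · exact Or.inl h
      · exact Or.inr ⟨hk.mul ht.inv h (by simp [h2, ht2]),
          (hk.side_mul ht.inv h).trans h1, (hk.side_mul_inv ht.inv h).trans (by simpa using ht1)⟩
    simpa using K.mul_mem this htK
  refine hs.le_of_isPrim_mem fun k hk => ?_
  rcases h1 : s k with _ | _ <;> rcases h2 : s k⁻¹ with _ | _
  · have hne : t * k ≠ 1 := fun h => by
      have : k = t⁻¹ := eq_inv_of_mul_eq_one_right h
      subst this
      simp_all
    have : t * k ∈ K := h12 _ (ht.mul hk hne (by simp [h1, ht2]))
      ((ht.side_mul hk hne).trans ht1) ((ht.side_mul_inv hk hne).trans h2)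
    exact (Subgroup.mul_mem_cancel_left K htK).1 this
  · exact K.inv_mem_iff.1 (h12 _ hk.inv h2 (by simpa using h1))
  · exact h12 k hk h1 h2
  · exact hX (Or.inr ⟨hk, h1, h2⟩)

/-- A subgroup with an element starting and ending on different sides is infinite cyclic or a
nontrivial free product. -/
theorem splits (hs : IsSided s l) {h : G} (hH : h ∈ H) (hne : h ≠ 1) (hside : s h ≠ s h⁻¹) :
    Nonempty (H ≃* Multiplicative ℤ) ∨
      ∃ P : Bool → GrpCat.{0}, (∀ b, Nontrivial (P b)) ∧
        Nonempty (H ≃* Monoid.CoprodI (fun b => P b)) := by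
  by_cases hA : ∃ t, IsPrim s H t ∧ s t = true ∧ s t⁻¹ = false
  · obtain ⟨t, ht, ht1, ht2⟩ := hA
    by_cases hX : ∃ x ∈ hs.primSubgroup H true, x ≠ 1
    · right
      refine ⟨hnnFactors (hs.primSubgroup H true), ?_, ?_⟩
      · rintro (_ | _)
        · exact inferInstanceAs (Nontrivial (Multiplicative ℤ))
        · obtain ⟨x, hx, hx1⟩ := hX
          exact ⟨⟨⟨x, hx⟩, 1, fun h => hx1 (congrArg Subtype.val h)⟩⟩
      · have hr : (lift (hnnHom (hs.primSubgroup H true) t)).range = H := by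
          refine le_antisymm (lift_range_le _ _ ?_) ?_
          · rintro (_ | _)
            · rintro _ ⟨n, rfl⟩
              exact H.zpow_mem ht.mem _
            · rintro _ ⟨n, rfl⟩
              exact hs.primSubgroup_le true n.2
          · refine hs.le_of_primSubgroup_le_of_mem ht ht1 ht2 ?_ ?_
            · intro x hx
              exact ⟨of (i := true) (⟨x, hx⟩ : hs.primSubgroup H true), lift_of _ _⟩
            · refine ⟨of (i := false) (Multiplicative.ofAdd (1 : ℤ)), (lift_of _ _).trans ?_⟩
              exact (zpowersHom_apply _ t _).trans (zpow_one t)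
        exact ⟨((MonoidHom.ofInjective (hs.hnnHom_injective ht ht1 ht2 hX)).trans
          (MulEquiv.subgroupCongr hr)).symm⟩
    · left
      have hr : (zpowersHom G t).range = H := by
        refine le_antisymm ?_ ?_
        · rintro _ ⟨n, rfl⟩
          exact H.zpow_mem ht.mem _
        · refine hs.le_of_primSubgroup_le_of_mem ht ht1 ht2 ?_ ?_
          · intro x hx
            by_cases h1 : x = 1
            · rw [h1]; exact one_mem _
            · exact absurd ⟨x, hx, h1⟩ hX
          · exact ⟨Multiplicative.ofAdd 1, (zpowersHom_apply _ t _).trans (zpow_one t)⟩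
      exact ⟨((MonoidHom.ofInjective (hs.zpow_injective ht.ne_one (by simp [ht1, ht2]))).trans
          (MulEquiv.subgroupCongr hr)).symm⟩
  · right
    have hX : ∀ k, IsPrim s H k → k ∈ hs.primSubgroup H (s k) := by
      intro k hk
      refine Or.inr ⟨hk, rfl, ?_⟩
      rcases h1 : s k with _ | _ <;> rcases h2 : s k⁻¹ with _ | _
      · rfl
      · exact absurd ⟨_, hk.inv, h2, by simpa using h1⟩ hA
      · exact absurd ⟨_, hk, h1, h2⟩ hA
      · rfl
    refine ⟨fun b => GrpCat.of (hs.primSubgroup H b), ?_, ?_⟩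
    · intro b
      by_contra hb
      have hb' : ∀ x ∈ hs.primSubgroup H b, x = 1 := by
        intro x hx
        by_contra h1
        exact hb ⟨⟨⟨x, hx⟩, 1, fun h => h1 (congrArg Subtype.val h)⟩⟩
      have : H ≤ hs.primSubgroup H (!b) := hs.le_of_isPrim_mem fun k hk => by
        have hk' := hX k hk
        by_cases hsk : s k = b
        · exact absurd (hb' k (hsk ▸ hk')) hk.ne_one
        · have : s k = !b := by
            cases b <;> simpa using hsk
          rwa [← this]
      obtain ⟨-, h1, h2⟩ := (mem_primSubgroup.1 (this hH)).resolve_left hne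
      exact hside (h1.trans h2.symm)
    · have hr : (lift (fun b => (hs.primSubgroup H b).subtype)).range = H := by
        refine le_antisymm (lift_range_le _ _ ?_) ?_
        · intro b
          rw [Subgroup.range_subtype]
          exact hs.primSubgroup_le b
        · refine hs.le_of_isPrim_mem fun k hk => ?_
          exact ⟨of (i := s k) (⟨k, hX k hk⟩ : hs.primSubgroup H (s k)), lift_of _ _⟩
      exact ⟨((MonoidHom.ofInjective (injective_of_neWord _ fun i j w =>
        (hs.lift_primSubgroup_neWord w).1)).trans (MulEquiv.subgroupCongr hr)).symm⟩

end IsSided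

namespace Monoid.CoprodI

variable {κ : Type} {M : κ → Type} [∀ k, Group (M k)]

open scoped Classical in
/-- The index of the first letter of the reduced form of `g`. -/
noncomputable def fstIdx (g : CoprodI M) : Option κ := (Word.equiv g).fstIdx

open scoped Classical in
/-- The number of letters of the reduced form of `g`. -/
noncomputable def len (g : CoprodI M) : ℕ := (Word.equiv g).toList.length

lemma NeWord.equiv_prod [DecidableEq κ] [∀ k, DecidableEq (M k)] {i j : κ} (w : NeWord M i j) :
    Word.equiv w.prod = w.toWord :=
  Word.equiv.apply_symm_apply w.toWord

open scoped Classical in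
lemma fstIdx_neWord {i j : κ} (w : NeWord M i j) : fstIdx w.prod = some i := by
  rw [fstIdx, NeWord.equiv_prod, Word.fstIdx]
  change w.toList.head?.map _ = _
  rw [NeWord.toList_head?]
  rfl

open scoped Classical in
lemma len_neWord {i j : κ} (w : NeWord M i j) : len w.prod = w.toList.length := by
  rw [len, NeWord.equiv_prod]
  rfl

lemma fstIdx_inv_neWord {i j : κ} (w : NeWord M i j) : fstIdx w.prod⁻¹ = some j := by
  rw [← NeWord.inv_prod, fstIdx_neWord]

@[simp] lemma fstIdx_one : fstIdx (1 : CoprodI M) = none := by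
  classical
  have : Word.equiv (1 : CoprodI M) = Word.empty := by
    exact (Word.equiv.eq_symm_apply.1 Word.prod_empty.symm)
  rw [fstIdx, this]
  rfl

lemma reduced_mul {p q : CoprodI M} (hp : p ≠ 1) (hq : q ≠ 1) (h : fstIdx p⁻¹ ≠ fstIdx q) :
    p * q ≠ 1 ∧ fstIdx (p * q) = fstIdx p ∧ len (p * q) = len p + len q := by
  obtain ⟨i, j, w, rfl⟩ := exists_neWord hp
  obtain ⟨i', j', w', rfl⟩ := exists_neWord hq
  rw [fstIdx_inv_neWord, fstIdx_neWord] at h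
  have hne : j ≠ i' := fun e => h (by rw [e])
  rw [← NeWord.append_prod (hne := hne)]
  refine ⟨fun h1 => ?_, by rw [fstIdx_neWord, fstIdx_neWord], ?_⟩
  · have := fstIdx_neWord (w.append hne w')
    rw [h1, fstIdx_one] at this
    exact absurd this (by simp)
  · rw [len_neWord, len_neWord, len_neWord, NeWord.toList, List.length_append]

lemma fstIdx_mul {p q : CoprodI M} (hp : p ≠ 1) (h : fstIdx p⁻¹ ≠ fstIdx q) :
    fstIdx (p * q) = fstIdx p := by
  by_cases hq : q = 1
  · rw [hq, mul_one]
  · exact (reduced_mul hp hq h).2.1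

lemma len_mul {p q : CoprodI M} (hp : p ≠ 1) (hq : q ≠ 1) (h : fstIdx p⁻¹ ≠ fstIdx q) :
    len (p * q) = len p + len q := (reduced_mul hp hq h).2.2

lemma fstIdx_eq_none {g : CoprodI M} : fstIdx g = none ↔ g = 1 := by
  refine ⟨fun h => ?_, fun h => by rw [h, fstIdx_one]⟩
  by_contra hne
  obtain ⟨i, j, w, rfl⟩ := exists_neWord hne
  rw [fstIdx_neWord] at h
  simp at h

lemma len_pos {g : CoprodI M} (hg : g ≠ 1) : 0 < len g := by
  obtain ⟨i, j, w, rfl⟩ := exists_neWord hg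
  rw [len_neWord]
  exact List.length_pos_iff.2 w.toList_ne_nil

lemma fstIdx_of {k : κ} {m : M k} (hm : m ≠ 1) : fstIdx (of m) = some k := by
  rw [← NeWord.prod_singleton m hm, fstIdx_neWord]

lemma len_of {k : κ} {m : M k} (hm : m ≠ 1) : len (of m) = 1 := by
  rw [← NeWord.prod_singleton m hm, len_neWord]
  rfl

lemma of_ne_one {k : κ} {m : M k} (hm : m ≠ 1) : (of m : CoprodI M) ≠ 1 := fun h => by
  have := fstIdx_of hm
  rw [h, fstIdx_one] at this
  simp at this

open scoped Classical in
lemma isSided (k : κ) : IsSided (fun g : CoprodI M => decide (fstIdx g = some k)) len := by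
  have h : ∀ p q : CoprodI M, (decide (fstIdx p⁻¹ = some k) : Bool) ≠
      decide (fstIdx q = some k) → fstIdx p⁻¹ ≠ fstIdx q := by
    intro p q h h'
    rw [h'] at h
    exact h rfl
  exact
    { mul_ne_one := fun p q hp hq hs => (reduced_mul hp hq (h p q hs)).1
      side_mul := fun p q hp hq hs => by simp only [(reduced_mul hp hq (h p q hs)).2.1]
      length_mul := fun p q hp hq hs => len_mul hp hq (h p q hs)
      length_pos := fun p hp => len_pos hp }

lemma exists_of_mul (k : κ) (g : CoprodI M) :
    ∃ (a : M k) (r : CoprodI M), g = of a * r ∧ fstIdx r ≠ some k := by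
  classical
  have h : Word.rcons (Word.equivPair k (Word.equiv g)) = Word.equiv g := by
    rw [← Word.equivPair_symm, Equiv.symm_apply_apply]
  refine ⟨(Word.equivPair k (Word.equiv g)).head, (Word.equivPair k (Word.equiv g)).tail.prod,
    ?_, ?_⟩
  · rw [← Word.prod_rcons, h]
    exact (Word.equiv.symm_apply_apply g).symm
  · have : Word.equiv (Word.equivPair k (Word.equiv g)).tail.prod =
        (Word.equivPair k (Word.equiv g)).tail := Word.equiv.apply_symm_apply _
    have h2 := (Word.equivPair k (Word.equiv g)).fstIdx_ne
    rw [← this] at h2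
    exact h2

/-- A normal form for double cosets of a factor. -/
lemma exists_of_mul_mul_of (k : κ) (g : CoprodI M) :
    g ∈ (of (M := M) (i := k)).range ∨ ∃ (a b : M k) (r : CoprodI M),
      g = of a * r * of b ∧ r ≠ 1 ∧ fstIdx r ≠ some k ∧ fstIdx r⁻¹ ≠ some k := by
  obtain ⟨a, r₁, rfl, h₁⟩ := exists_of_mul k g
  obtain ⟨b, r₂, h, h₂⟩ := exists_of_mul k r₁⁻¹
  by_cases hr : r₂ = 1
  · left
    rw [hr, mul_one] at h
    rw [← inv_inv r₁, h]
    exact mul_mem ⟨a, rfl⟩ (inv_mem ⟨b, rfl⟩)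
  · right
    have e : r₁ = r₂⁻¹ * of b⁻¹ := by rw [← inv_inv r₁, h, mul_inv_rev, map_inv]
    refine ⟨a, b⁻¹, r₂⁻¹, by rw [e, mul_assoc], inv_ne_one.2 hr, ?_, by rwa [inv_inv]⟩
    by_cases hb : b = 1
    · rw [hb, inv_one, map_one, mul_one] at e
      rwa [← e]
    · rw [e, fstIdx_mul (inv_ne_one.2 hr)] at h₁
      · exact h₁
      · rwa [inv_inv, fstIdx_of (inv_ne_one.2 hb)]

/-- A subgroup of a free product is elliptic if it is conjugate into a factor. -/
def IsElliptic (H : Subgroup (CoprodI M)) : Prop :=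
  ∃ (k : κ) (g : CoprodI M), ∀ h ∈ H, g⁻¹ * h * g ∈ (of (M := M) (i := k)).range

lemma exists_conj_len_one (n : ℕ) : ∀ c : CoprodI M, len c = n → c ≠ 1 →
    ∃ g : CoprodI M, fstIdx (g⁻¹ * c * g) ≠ fstIdx (g⁻¹ * c * g)⁻¹ ∨
      ∃ k : κ, g⁻¹ * c * g ∈ (of (M := M) (i := k)).range := by
  induction n using Nat.strong_induction_on with
  | _ n ih =>
  intro c hn hc
  by_cases h : fstIdx c = fstIdx c⁻¹
  swap
  · exact ⟨1, Or.inl (by simpa using h)⟩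
  obtain ⟨k, hk⟩ : ∃ k, fstIdx c = some k := by
    rcases hf : fstIdx c with _ | k
    · exact absurd (fstIdx_eq_none.1 hf) hc
    · exact ⟨k, rfl⟩
  rcases exists_of_mul_mul_of k c with hr | ⟨a, b, r, rfl, hr, hr1, hr2⟩
  · exact ⟨1, Or.inr ⟨k, by simpa using hr⟩⟩
  have ha : a ≠ 1 := by
    rintro rfl
    rw [map_one, one_mul] at hk
    rw [fstIdx_mul hr] at hk
    · exact hr1 hk
    · by_cases hb : b = 1
      · rw [hb, map_one, fstIdx_one]
        exact fun h => hr (inv_eq_one.1 (fstIdx_eq_none.1 h))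
      · rwa [fstIdx_of hb]
  have hlen : ∀ d : M k, len (r * of d) ≤ len r + 1 := by
    intro d
    by_cases hd : d = 1
    · rw [hd, map_one, mul_one]; omega
    · rw [len_mul hr (of_ne_one hd) (by rwa [fstIdx_of hd]), len_of hd]
  have hb : b ≠ 1 := by
    rintro rfl
    rw [hk, map_one, mul_one, mul_inv_rev, fstIdx_mul (inv_ne_one.2 hr)] at h
    · exact hr2 h.symm
    · rwa [inv_inv, ← map_inv, fstIdx_of (inv_ne_one.2 ha)]
  have hl : len (of a * r * of b) = 1 + len r + 1 := by
    have h1 := reduced_mul (of_ne_one ha) hr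
      (by rw [← map_inv, fstIdx_of (inv_ne_one.2 ha)]; exact hr1.symm)
    rw [len_mul h1.1 (of_ne_one hb), h1.2.2, len_of ha, len_of hb]
    rw [mul_inv_rev, fstIdx_mul (inv_ne_one.2 hr), fstIdx_of hb]
    · exact hr2
    · rwa [inv_inv, ← map_inv, fstIdx_of (inv_ne_one.2 ha)]
  have e : (of a)⁻¹ * (of a * r * of b) * of a = r * of (b * a) := by
    rw [map_mul]; group
  have hne : r * of (b * a) ≠ 1 := by
    rw [← e]
    intro h1
    apply hc
    have : of a * r * of b = of a * ((of a)⁻¹ * (of a * r * of b) * of a) * (of a)⁻¹ := by group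
    rw [this, h1]; group
  obtain ⟨g, hg⟩ := ih (len (r * of (b * a))) (by have := hlen (b * a); omega) _ rfl hne
  refine ⟨of a * g, ?_⟩
  have e2 : (of a * g)⁻¹ * (of a * r * of b) * (of a * g) = g⁻¹ * (r * of (b * a)) * g := by
    rw [map_mul]; group
  rwa [e2]

lemma exists_hyperbolic [Nonempty κ] {H : Subgroup (CoprodI M)} (hH : ¬ IsElliptic H) :
    ∃ (g : CoprodI M), ∃ h ∈ H, fstIdx (g⁻¹ * h * g) ≠ fstIdx (g⁻¹ * h * g)⁻¹ := by
  have hne : ∃ h ∈ H, h ≠ 1 := by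
    by_contra hcon
    push Not at hcon
    refine hH ⟨Classical.arbitrary κ, 1, fun h hh => ?_⟩
    rw [hcon h hh]
    simp
  obtain ⟨h, hh, hh1⟩ := hne
  obtain ⟨g, hg | ⟨k, hk⟩⟩ := exists_conj_len_one (len h) h rfl hh1
  · exact ⟨g, h, hh, hg⟩
  obtain ⟨h', hh', hk'⟩ : ∃ h' ∈ H, g⁻¹ * h' * g ∉ (of (M := M) (i := k)).range := by
    by_contra hcon
    push Not at hcon
    exact hH ⟨k, g, hcon⟩
  obtain ⟨m, hm⟩ := hk
  obtain ⟨a, b, r, he, hr, hr1, hr2⟩ := (exists_of_mul_mul_of k _).resolve_left hk'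
  have hm1 : m ≠ 1 := by
    rintro rfl
    rw [map_one, eq_comm, mul_eq_one_iff_eq_inv, inv_mul_eq_iff_eq_mul] at hm
    exact hh1 (by rw [hm]; group)
  have e1 : (g * of a)⁻¹ * h' * (g * of a) = r * of (b * a) := by
    have : (g * of a)⁻¹ * h' * (g * of a) = (of a)⁻¹ * (g⁻¹ * h' * g) * of a := by group
    rw [this, he, map_mul]; group
  have e2 : (g * of a)⁻¹ * h * (g * of a) = of (a⁻¹ * m * a) := by
    have : (g * of a)⁻¹ * h * (g * of a) = (of a)⁻¹ * (g⁻¹ * h * g) * of a := by group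
    rw [this, ← hm, map_mul, map_mul, map_inv]
  have hm2 : a⁻¹ * m * a ≠ 1 := by
    intro h
    apply hm1
    have : m = a * (a⁻¹ * m * a) * a⁻¹ := by group
    rw [this, h]; group
  refine ⟨g * of a, ?_⟩
  by_cases hba : b * a = 1
  · refine ⟨h * h', H.mul_mem hh hh', ?_⟩
    have : (g * of a)⁻¹ * (h * h') * (g * of a) =
        ((g * of a)⁻¹ * h * (g * of a)) * ((g * of a)⁻¹ * h' * (g * of a)) := by group
    rw [this, e1, e2, hba, map_one, mul_one, mul_inv_rev, ← map_inv,
      fstIdx_mul (of_ne_one hm2), fstIdx_mul (inv_ne_one.2 hr), fstIdx_of hm2]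
    · exact hr2.symm
    · rw [inv_inv, fstIdx_of (inv_ne_one.2 hm2)]
      exact hr1
    · rw [← map_inv, fstIdx_of (inv_ne_one.2 hm2)]
      exact hr1.symm
  · refine ⟨h', hh', ?_⟩
    rw [e1, mul_inv_rev, ← map_inv, fstIdx_mul hr, fstIdx_mul (of_ne_one (inv_ne_one.2 hba)),
      fstIdx_of (inv_ne_one.2 hba)]
    · exact hr1
    · rw [← map_inv, inv_inv, fstIdx_of hba]
      exact hr2.symm
    · rw [fstIdx_of hba]
      exact hr2

/-- A weak form of the Kurosh subgroup theorem. -/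
theorem isElliptic_or_splits [Nonempty κ] (H : Subgroup (CoprodI M)) :
    IsElliptic H ∨ Nonempty (H ≃* Multiplicative ℤ) ∨
      ∃ P : Bool → GrpCat.{0}, (∀ b, Nontrivial (P b)) ∧
        Nonempty (H ≃* CoprodI (fun b => P b)) := by
  classical
  by_cases hH : IsElliptic H
  · exact Or.inl hH
  right
  obtain ⟨g, h, hh, hne⟩ := exists_hyperbolic hH
  let f : CoprodI M ≃* CoprodI M := MulAut.conj g⁻¹
  have hf : ∀ x, f x = g⁻¹ * x * g := fun x => by simp [f]
  let E : H ≃* H.map f.toMonoidHom := H.equivMapOfInjective f.toMonoidHom f.injective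
  have hc : f h ∈ H.map f.toMonoidHom := ⟨h, hh, rfl⟩
  rw [← hf] at hne
  have hne1 : f h ≠ 1 := fun h1 => hne (by rw [h1, inv_one])
  obtain ⟨k, hk⟩ : ∃ k, fstIdx (f h) = some k := by
    rcases hx : fstIdx (f h) with _ | k
    · exact absurd (fstIdx_eq_none.1 hx) hne1
    · exact ⟨k, rfl⟩
  have hs : (decide (fstIdx (f h) = some k) : Bool) ≠ decide (fstIdx (f h)⁻¹ = some k) := by
    rw [hk] at hne
    simp [hk, hne.symm]
  rcases (isSided k).splits hc hne1 hs with ⟨⟨e⟩⟩ | ⟨P, hP, ⟨e⟩⟩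
  · exact Or.inl ⟨E.trans e⟩
  · exact Or.inr ⟨P, hP, ⟨E.trans e⟩⟩

end Monoid.CoprodI

/-- The groupoid generated by a labelled graph `R`. -/
inductive GroupoidClosure {V A : Type*} [Group A] (R : V → V → A → Prop) : V → V → A → Prop
  | gen {u v a} : R u v a → GroupoidClosure R u v a
  | one (u) : GroupoidClosure R u u 1
  | inv {u v a} : GroupoidClosure R u v a → GroupoidClosure R v u a⁻¹
  | mul {u v w a b} : GroupoidClosure R u v a → GroupoidClosure R v w b →
      GroupoidClosure R u w (a * b)

namespace GroupoidClosure

variable {V A : Type*} [Group A] {R S : V → V → A → Prop}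

lemma bind (h : ∀ u v a, R u v a → GroupoidClosure S u v a) {u v a}
    (H : GroupoidClosure R u v a) : GroupoidClosure S u v a := by
  induction H with
  | gen hr => exact h _ _ _ hr
  | one u => exact one u
  | inv _ ih => exact ih.inv
  | mul _ _ ih₁ ih₂ => exact ih₁.mul ih₂

lemma mono (h : ∀ u v a, R u v a → S u v a) {u v a}
    (H : GroupoidClosure R u v a) : GroupoidClosure S u v a :=
  H.bind fun _ _ _ hr => gen (h _ _ _ hr)

/-- Transport along a map of vertices and a relabelling. -/
lemma transport {V' : Type*} {T : V' → V' → A → Prop} (f : V → V') (p : V → A)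
    (h : ∀ u v a, R u v a → GroupoidClosure T (f u) (f v) (p u * a * (p v)⁻¹)) {u v a}
    (H : GroupoidClosure R u v a) : GroupoidClosure T (f u) (f v) (p u * a * (p v)⁻¹) := by
  induction H with
  | gen hr => exact h _ _ _ hr
  | one u => simpa using one (f u)
  | inv _ ih => convert ih.inv using 1; group
  | mul _ _ ih₁ ih₂ => convert ih₁.mul ih₂ using 1; group

/-- The vertex group as a subgroup. -/
def vertexGroup (R : V → V → A → Prop) (u : V) : Subgroup A where
  carrier := {a | GroupoidClosure R u u a}
  one_mem' := one u
  inv_mem' := inv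
  mul_mem' := mul

lemma mem_vertexGroup {u : V} {a : A} : a ∈ vertexGroup R u ↔ GroupoidClosure R u u a := Iff.rfl

lemma eq_or_mem {W : Set V} (h : ∀ u v a, R u v a → u ∈ W ∧ v ∈ W) {u v a}
    (H : GroupoidClosure R u v a) : u = v ∨ u ∈ W ∧ v ∈ W := by
  induction H with
  | gen hr => exact Or.inr (h _ _ _ hr)
  | one u => exact Or.inl rfl
  | inv _ ih => exact ih.imp Eq.symm And.symm
  | mul _ _ ih₁ ih₂ =>
    rcases ih₁ with rfl | ih₁
    · exact ih₂
    · rcases ih₂ with rfl | ih₂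
      · exact Or.inr ih₁
      · exact Or.inr ⟨ih₁.1, ih₂.2⟩

/-- Paths in a graph with one edge added. -/
lemma of_add_edge {x y : V} {c : A} {u v a}
    (H : GroupoidClosure (fun u v a => R u v a ∨ u = x ∧ v = y ∧ a = c) u v a) :
    (∃ b, GroupoidClosure R u v b) ∨
      (∃ p q, GroupoidClosure R u x p ∧ GroupoidClosure R y v q) ∨
      (∃ p q, GroupoidClosure R u y p ∧ GroupoidClosure R x v q) := by
  induction H with
  | gen hr =>
    rcases hr with hr | ⟨rfl, rfl, rfl⟩
    · exact Or.inl ⟨_, gen hr⟩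
    · exact Or.inr (Or.inl ⟨1, 1, one _, one _⟩)
  | one u => exact Or.inl ⟨1, one u⟩
  | inv _ ih =>
    rcases ih with ⟨b, hb⟩ | ⟨p, q, hp, hq⟩ | ⟨p, q, hp, hq⟩
    · exact Or.inl ⟨_, hb.inv⟩
    · exact Or.inr (Or.inr ⟨_, _, hq.inv, hp.inv⟩)
    · exact Or.inr (Or.inl ⟨_, _, hq.inv, hp.inv⟩)
  | mul _ _ ih₁ ih₂ =>
    rcases ih₁ with ⟨b, hb⟩ | ⟨p, q, hp, hq⟩ | ⟨p, q, hp, hq⟩ <;>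
    rcases ih₂ with ⟨b', hb'⟩ | ⟨p', q', hp', hq'⟩ | ⟨p', q', hp', hq'⟩
    · exact Or.inl ⟨_, hb.mul hb'⟩
    · exact Or.inr (Or.inl ⟨_, _, hb.mul hp', hq'⟩)
    · exact Or.inr (Or.inr ⟨_, _, hb.mul hp', hq'⟩)
    · exact Or.inr (Or.inl ⟨_, _, hp, hq.mul hb'⟩)
    · exact Or.inr (Or.inl ⟨_, _, hp, hq'⟩)
    · exact Or.inl ⟨_, hp.mul hq'⟩
    · exact Or.inr (Or.inr ⟨_, _, hp, hq.mul hb'⟩)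
    · exact Or.inl ⟨_, hp.mul hq'⟩
    · exact Or.inr (Or.inr ⟨_, _, hp, hq'⟩)

end GroupoidClosure

namespace Monoid.CoprodI

variable {κ : Type} {M : κ → Type} [∀ k, Group (M k)] {A : Type} [Group A]

/-- Reduced paths through a graph of coloured groupoids. -/
inductive RedPath {V : Type*} (ψ : A →* CoprodI M) (Γ : κ → V → V → A → Prop) :
    Option κ → V → V → CoprodI M → Prop
  | nil (u) : RedPath ψ Γ none u u 1
  | cons {k u w v g o y} : GroupoidClosure (Γ k) u w g → ψ g ≠ 1 → o ≠ some k →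
      RedPath ψ Γ o w v y → RedPath ψ Γ (some k) u v (ψ g * y)

section

variable {V : Type*} {ψ : A →* CoprodI M} {Γ : κ → V → V → A → Prop}

lemma mem_range_of_groupoidClosure
    (hΓ : ∀ k u v a, Γ k u v a → ψ a ∈ (of (M := M) (i := k)).range) {k u v a}
    (h : GroupoidClosure (Γ k) u v a) : ψ a ∈ (of (M := M) (i := k)).range := by
  induction h with
  | gen hr => exact hΓ _ _ _ _ hr
  | one u => rw [map_one]; exact one_mem _
  | inv _ ih => rw [map_inv]; exact inv_mem ih
  | mul _ _ ih₁ ih₂ => rw [map_mul]; exact mul_mem ih₁ ih₂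

lemma RedPath.fstIdx_eq (hΓ : ∀ k u v a, Γ k u v a → ψ a ∈ (of (M := M) (i := k)).range)
    {o u v y} (h : RedPath ψ Γ o u v y) : fstIdx y = o := by
  induction h with
  | nil u => exact fstIdx_one
  | @cons k u w v g o y hg hne ho _ ih =>
    obtain ⟨m, hm⟩ := mem_range_of_groupoidClosure hΓ hg
    have hm1 : m ≠ 1 := by
      rintro rfl
      exact hne (by rw [← hm, map_one])
    rw [← hm, fstIdx_mul (of_ne_one hm1), fstIdx_of hm1]
    rw [← map_inv, fstIdx_of (inv_ne_one.2 hm1), ih]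
    exact ho.symm

lemma RedPath.eq_of_none {o u v y} (h : RedPath ψ Γ o u v y) (ho : o = none) : u = v := by
  cases h with
  | nil => rfl
  | cons => simp at ho

lemma RedPath.mul (ht : ∀ k u v a, GroupoidClosure (Γ k) u v a → ψ a = 1 → u = v) {k u u' g}
    (hg : GroupoidClosure (Γ k) u' u g) {o v y} (h : RedPath ψ Γ o u v y) :
    ∃ o', RedPath ψ Γ o' u' v (ψ g * y) := by
  by_cases h1 : ψ g = 1
  · rw [h1, one_mul, ht k _ _ _ hg h1]
    exact ⟨o, h⟩
  by_cases ho : o = some k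
  swap
  · exact ⟨_, .cons hg h1 ho h⟩
  cases h with
  | nil => simp at ho
  | @cons k' _ w _ g' o' y' hg' h1' ho' h' =>
    obtain rfl : k' = k := by simpa using ho
    rw [← mul_assoc, ← map_mul]
    by_cases h2 : ψ (g * g') = 1
    · rw [h2, one_mul, ht _ _ _ _ (hg.mul hg') h2]
      exact ⟨_, h'⟩
    · exact ⟨_, .cons (hg.mul hg') h2 ho' h'⟩

lemma RedPath.of_groupoidClosure
    (ht : ∀ k u v a, GroupoidClosure (Γ k) u v a → ψ a = 1 → u = v) {u u' g}
    (hg : GroupoidClosure (fun u v a => ∃ k, Γ k u v a) u' u g) :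
    (∀ o v y, RedPath ψ Γ o u v y → ∃ o', RedPath ψ Γ o' u' v (ψ g * y)) ∧
    (∀ o v y, RedPath ψ Γ o u' v y → ∃ o', RedPath ψ Γ o' u v (ψ g⁻¹ * y)) := by
  induction hg with
  | gen hr =>
    obtain ⟨k, hr⟩ := hr
    exact ⟨fun o v y h => h.mul ht (.gen hr), fun o v y h => h.mul ht (GroupoidClosure.gen hr).inv⟩
  | one u => simpa using fun o v y h => ⟨o, h⟩
  | inv _ ih => exact ⟨ih.2, by simpa using ih.1⟩
  | mul _ _ ih₁ ih₂ =>
    constructor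
    · intro o v y h
      obtain ⟨o', h'⟩ := ih₂.1 _ _ _ h
      rw [map_mul, mul_assoc]
      exact ih₁.1 _ _ _ h'
    · intro o v y h
      obtain ⟨o', h'⟩ := ih₁.2 _ _ _ h
      rw [mul_inv_rev, map_mul, mul_assoc]
      exact ih₂.2 _ _ _ h'

/-- A graph of coloured groupoids mapping onto a free product with more than one vertex has two
vertices that can be identified. -/
lemma exists_tie (hΓ : ∀ k u v a, Γ k u v a → ψ a ∈ (of (M := M) (i := k)).range) {u v : V}
    (huv : u ≠ v) (h : GroupoidClosure (fun u v a => ∃ k, Γ k u v a) u v 1) :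
    ∃ k u v a, GroupoidClosure (Γ k) u v a ∧ ψ a = 1 ∧ u ≠ v := by
  by_contra hcon
  push Not at hcon
  obtain ⟨o, hp⟩ := (RedPath.of_groupoidClosure hcon h).1 _ _ _ (.nil v)
  have := hp.fstIdx_eq hΓ
  rw [map_one, mul_one, fstIdx_one] at this
  exact huv (hp.eq_of_none this.symm)

end

end Monoid.CoprodI

namespace Monoid.CoprodI

variable {κ : Type} {M : κ → Type} [∀ k, Group (M k)] {A : Type} [Group A] {E : Type}

/-- A loop labelled by a conjugate of a subgroup. -/
structure EllLoop (κ A : Type) where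
  /-- the vertex -/
  vert : ℕ
  /-- the colour -/
  col : κ
  /-- the conjugating element -/
  conj : A

/-- The generators of a given colour. -/
def foldGen (L : E → Subgroup A) (J : Multiset (κ × ℕ × ℕ × A)) (l : E → EllLoop κ A) (k : κ)
    (u v : ℕ) (a : A) : Prop :=
  (k, u, v, a) ∈ J ∨ ∃ i, (l i).vert = u ∧ (l i).vert = v ∧ (l i).col = k ∧
    ∃ x ∈ L i, (l i).conj * x * (l i).conj⁻¹ = a

lemma foldGen_mono {L : E → Subgroup A} {J J' : Multiset (κ × ℕ × ℕ × A)} {l : E → EllLoop κ A}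
    (h : J ≤ J') {k u v a} (hg : foldGen L J l k u v a) : foldGen L J' l k u v a :=
  hg.imp (fun h' => Multiset.mem_of_le h h') id

/-- A graph of coloured groupoids with vertex set `W` generated by the edges `J` and the loops `l`,
which represents all of `A`. -/
structure IsFolding (ψ : A →* CoprodI M) (L : E → Subgroup A) (W : Finset ℕ)
    (J : Multiset (κ × ℕ × ℕ × A)) (l : E → EllLoop κ A) : Prop where
  mem_of_edge : ∀ k u v a, (k, u, v, a) ∈ J → u ∈ W ∧ v ∈ W
  vert_mem : ∀ i, (l i).vert ∈ W
  edge_col : ∀ k u v a, (k, u, v, a) ∈ J → ψ a ∈ (of (M := M) (i := k)).range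
  loop_col : ∀ i, ∀ x ∈ L i,
    ψ ((l i).conj * x * (l i).conj⁻¹) ∈ (of (M := M) (i := (l i).col)).range
  full : ∀ u ∈ W, ∀ v ∈ W, ∀ a,
    GroupoidClosure (fun u v a => ∃ k, foldGen L J l k u v a) u v a

variable {ψ : A →* CoprodI M} {L : E → Subgroup A} {W : Finset ℕ}
  {J : Multiset (κ × ℕ × ℕ × A)} {l : E → EllLoop κ A}

lemma IsFolding.gen_mem (h : IsFolding ψ L W J l) (k u v a) (hg : foldGen L J l k u v a) :
    u ∈ W ∧ v ∈ W := by
  rcases hg with hg | ⟨i, rfl, rfl, -, -⟩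
  · exact h.mem_of_edge _ _ _ _ hg
  · exact ⟨h.vert_mem i, h.vert_mem i⟩

lemma IsFolding.gen_col (h : IsFolding ψ L W J l) (k u v a) (hg : foldGen L J l k u v a) :
    ψ a ∈ (of (M := M) (i := k)).range := by
  rcases hg with hg | ⟨i, rfl, -, rfl, x, hx, rfl⟩
  · exact h.edge_col _ _ _ _ hg
  · exact h.loop_col i x hx

/-- A connection between two vertices uses some edge only once. -/
lemma exists_cut_edge (L : E → Subgroup A) (l : E → EllLoop κ A) {k u v} (huv : u ≠ v)
    (J : Multiset (κ × ℕ × ℕ × A)) {a} (h : GroupoidClosure (foldGen L J l k) u v a) :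
    ∃ J₀ x y c, J = (k, x, y, c) ::ₘ J₀ ∧
      ((∃ p q, GroupoidClosure (foldGen L J₀ l k) u x p ∧
        GroupoidClosure (foldGen L J₀ l k) y v q) ∨
      (∃ p q, GroupoidClosure (foldGen L J₀ l k) u y p ∧
        GroupoidClosure (foldGen L J₀ l k) x v q)) := by
  induction J using Multiset.induction_on generalizing a with
  | empty =>
    exfalso
    have : ∀ u v a, GroupoidClosure (foldGen L 0 l k) u v a → u = v := by
      intro u v a h
      induction h with
      | gen hr =>
        rcases hr with hr | ⟨i, rfl, rfl, -⟩
        · simp at hr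
        · rfl
      | one u => rfl
      | inv _ ih => exact ih.symm
      | mul _ _ ih₁ ih₂ => exact ih₁.trans ih₂
    exact huv (this _ _ _ h)
  | cons e J ih =>
    by_cases hJ : ∃ b, GroupoidClosure (foldGen L J l k) u v b
    · obtain ⟨b, hb⟩ := hJ
      obtain ⟨J₀, x, y, c, rfl, hc⟩ := ih hb
      have hm : ∀ u v a, foldGen L J₀ l k u v a → foldGen L (e ::ₘ J₀) l k u v a :=
        fun _ _ _ => foldGen_mono (Multiset.le_cons_self _ _)
      refine ⟨e ::ₘ J₀, x, y, c, Multiset.cons_swap _ _ _, ?_⟩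
      rcases hc with ⟨p, q, hp, hq⟩ | ⟨p, q, hp, hq⟩
      · exact Or.inl ⟨p, q, hp.mono hm, hq.mono hm⟩
      · exact Or.inr ⟨p, q, hp.mono hm, hq.mono hm⟩
    · obtain ⟨k', x, y, c⟩ := e
      by_cases hk : k' = k
      · subst hk
        refine ⟨J, x, y, c, rfl, ?_⟩
        refine (GroupoidClosure.of_add_edge (x := x) (y := y) (c := c) (h.mono ?_)).resolve_left hJ
        rintro u v a (hr | hr)
        · rcases Multiset.mem_cons.1 hr with hr | hr
          · simp only [Prod.mk.injEq, true_and] at hr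
            exact Or.inr hr
          · exact Or.inl (Or.inl hr)
        · exact Or.inl (Or.inr hr)
      · refine absurd ⟨a, h.mono ?_⟩ hJ
        rintro u v a (hr | hr)
        · rcases Multiset.mem_cons.1 hr with hr | hr
          · simp only [Prod.mk.injEq] at hr
            exact absurd hr.1.symm hk
          · exact Or.inl hr
        · exact Or.inr hr

/-- A connection between two vertices can be replaced by a single edge. -/
lemma IsFolding.exists_edge (h : IsFolding ψ L W J l) {k u v a} (huv : u ≠ v)
    (ha : GroupoidClosure (foldGen L J l k) u v a) :
    ∃ J₀ b, J.card = J₀.card + 1 ∧ IsFolding ψ L W ((k, u, v, b) ::ₘ J₀) l ∧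
      GroupoidClosure (foldGen L ((k, u, v, b) ::ₘ J₀) l k) u v a := by
  obtain ⟨J₀, x, y, c, rfl, hc⟩ := exists_cut_edge L l huv J ha
  have huvW := (ha.eq_or_mem (W := (W : Set ℕ)) (h.gen_mem k)).resolve_left huv
  have hm : ∀ e k u v a, foldGen L J₀ l k u v a → foldGen L (e ::ₘ J₀) l k u v a :=
    fun _ _ _ _ _ => foldGen_mono (Multiset.le_cons_self _ _)
  obtain ⟨b, hb, hb'⟩ : ∃ b, GroupoidClosure (foldGen L ((k, x, y, c) ::ₘ J₀) l k) u v b ∧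
      GroupoidClosure (foldGen L ((k, u, v, b) ::ₘ J₀) l k) x y c := by
    have hg : ∀ x y c, GroupoidClosure (foldGen L ((k, x, y, c) ::ₘ J₀) l k) x y c :=
      fun x y c => .gen (Or.inl (Multiset.mem_cons_self _ _))
    rcases hc with ⟨p, q, hp, hq⟩ | ⟨p, q, hp, hq⟩
    · refine ⟨p * c * q, ((hp.mono (hm _ k)).mul (hg x y c)).mul (hq.mono (hm _ k)), ?_⟩
      have := ((hp.mono (hm _ k)).inv.mul (hg u v (p * c * q))).mul (hq.mono (hm _ k)).inv
      convert this using 1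
      group
    · refine ⟨p * c⁻¹ * q, ((hp.mono (hm _ k)).mul (hg x y c).inv).mul (hq.mono (hm _ k)), ?_⟩
      have := ((hq.mono (hm _ k)).mul (hg u v (p * c⁻¹ * q)).inv).mul (hp.mono (hm _ k))
      convert this using 1
      group
  have hsub : ∀ k' u' v' a', foldGen L ((k, x, y, c) ::ₘ J₀) l k' u' v' a' →
      GroupoidClosure (foldGen L ((k, u, v, b) ::ₘ J₀) l k') u' v' a' := by
    rintro k' u' v' a' (hr | hr)
    · rcases Multiset.mem_cons.1 hr with hr | hr
      · simp only [Prod.mk.injEq] at hr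
        obtain ⟨rfl, rfl, rfl, rfl⟩ := hr
        exact hb'
      · exact .gen (hm _ _ _ _ _ (Or.inl hr))
    · exact .gen (Or.inr hr)
  refine ⟨J₀, b, by simp, ⟨?_, h.vert_mem, ?_, h.loop_col, ?_⟩, ha.bind (hsub k)⟩
  · intro k' u' v' a' hr
    rcases Multiset.mem_cons.1 hr with hr | hr
    · simp only [Prod.mk.injEq] at hr
      obtain ⟨rfl, rfl, rfl, rfl⟩ := hr
      exact huvW
    · exact h.mem_of_edge _ _ _ _ (Multiset.mem_cons_of_mem hr)
  · intro k' u' v' a' hr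
    rcases Multiset.mem_cons.1 hr with hr | hr
    · simp only [Prod.mk.injEq] at hr
      obtain ⟨rfl, rfl, rfl, rfl⟩ := hr
      exact mem_range_of_groupoidClosure h.gen_col hb
    · exact h.edge_col _ _ _ _ (Multiset.mem_cons_of_mem hr)
  · intro u' hu' v' hv' a'
    refine (h.full u' hu' v' hv' a').bind ?_
    rintro u' v' a' ⟨k', hr⟩
    exact (hsub _ _ _ _ hr).mono fun _ _ _ hr => ⟨k', hr⟩

open scoped Classical in
/-- Identify two vertices along an element with trivial image. -/
lemma IsFolding.merge {J₀ : Multiset (κ × ℕ × ℕ × A)} {k u v a b}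
    (h : IsFolding ψ L W ((k, u, v, b) ::ₘ J₀) l) (huv : u ≠ v)
    (ha : GroupoidClosure (foldGen L ((k, u, v, b) ::ₘ J₀) l k) u v a) (ha1 : ψ a = 1) :
    ∃ (J' : Multiset (κ × ℕ × ℕ × A)) (l' : E → EllLoop κ A), J'.card = J₀.card ∧
      IsFolding ψ L (W.erase u) J' l' := by
  let f : ℕ → ℕ := fun w => if w = u then v else w
  let π : ℕ → A := fun w => if w = u then a⁻¹ else 1
  let t : κ → ℕ → A := fun k' w => if w = u then (if k' = k then b⁻¹ else a⁻¹) else 1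
  obtain ⟨huW, hvW⟩ := h.mem_of_edge k u v b (Multiset.mem_cons_self _ _)
  have hb := h.edge_col k u v b (Multiset.mem_cons_self _ _)
  have hf : ∀ w ∈ W, f w ∈ W.erase u := by
    intro w hw
    by_cases hwu : w = u
    · simp only [f, hwu, if_true]
      exact Finset.mem_erase.2 ⟨huv.symm, hvW⟩
    · simp only [f, hwu, if_false]
      exact Finset.mem_erase.2 ⟨hwu, hw⟩
  have ht : ∀ k' w, ψ (t k' w) ∈ (of (M := M) (i := k')).range := by
    intro k' w
    simp only [t]
    split_ifs with h1 h2
    · subst h2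
      rw [map_inv]; exact inv_mem hb
    · rw [map_inv, ha1, inv_one]; exact one_mem _
    · rw [map_one]; exact one_mem _
  let J' : Multiset (κ × ℕ × ℕ × A) := J₀.map fun e =>
    (e.1, f e.2.1, f e.2.2.1, t e.1 e.2.1 * e.2.2.2 * (t e.1 e.2.2.1)⁻¹)
  let l' : E → EllLoop κ A := fun i =>
    ⟨f (l i).vert, (l i).col, t (l i).col (l i).vert * (l i).conj⟩
  have hgen : ∀ k' u' v' a', foldGen L ((k, u, v, b) ::ₘ J₀) l k' u' v' a' →
      GroupoidClosure (foldGen L J' l' k') (f u') (f v') (t k' u' * a' * (t k' v')⁻¹) := by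
    rintro k' u' v' a' (hr | ⟨i, rfl, h2, rfl, x, hx, rfl⟩)
    · rcases Multiset.mem_cons.1 hr with hr | hr
      · simp only [Prod.mk.injEq] at hr
        obtain ⟨rfl, rfl, rfl, rfl⟩ := hr
        convert GroupoidClosure.one (f v') using 1
        · simp [f]
        · simp [t, huv.symm]
      · exact .gen (Or.inl (Multiset.mem_map_of_mem _ hr))
    · refine .gen (Or.inr ⟨i, rfl, by rw [← h2], rfl, x, hx, ?_⟩)
      rw [← h2]
      simp only [l']
      group
  have htrans : ∀ k' u' v' a', GroupoidClosure (foldGen L ((k, u, v, b) ::ₘ J₀) l k') u' v' a' →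
      GroupoidClosure (foldGen L J' l' k') (f u') (f v') (t k' u' * a' * (t k' v')⁻¹) :=
    fun k' u' v' a' h' => h'.transport f (t k') (hgen k')
  have hfu : f u = v := by simp [f]
  have hfv : f v = v := by simp [f]
  have hab : GroupoidClosure (foldGen L J' l' k) v v (b⁻¹ * a) := by
    have := htrans k u v a ha
    rw [hfu, hfv] at this
    simpa [t, huv.symm] using this
  have hπt : ∀ k' w, GroupoidClosure (foldGen L J' l' k') (f w) (f w) (π w * (t k' w)⁻¹) := by
    intro k' w
    by_cases hw : w = u
    · by_cases hk : k' = k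
      · subst hw hk
        rw [hfu]
        convert hab.inv using 1
        simp [π, t]
      · convert GroupoidClosure.one _ using 1
        simp [π, t, hw, hk]
    · convert GroupoidClosure.one _ using 1
      simp [π, t, hw]
  refine ⟨J', l', Multiset.card_map _ _, ⟨?_, fun i => hf _ (h.vert_mem i), ?_, ?_, ?_⟩⟩
  · intro k' u' v' a' hr
    obtain ⟨e, he, hr⟩ := Multiset.mem_map.1 hr
    simp only [Prod.mk.injEq] at hr
    obtain ⟨rfl, rfl, rfl, rfl⟩ := hr
    have := h.mem_of_edge _ _ _ _ (Multiset.mem_cons_of_mem he)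
    exact ⟨hf _ this.1, hf _ this.2⟩
  · intro k' u' v' a' hr
    obtain ⟨e, he, hr⟩ := Multiset.mem_map.1 hr
    simp only [Prod.mk.injEq] at hr
    obtain ⟨rfl, rfl, rfl, rfl⟩ := hr
    have := h.edge_col _ _ _ _ (Multiset.mem_cons_of_mem he)
    rw [map_mul, map_mul, map_inv]
    exact mul_mem (mul_mem (ht _ _) this) (inv_mem (ht _ _))
  · intro i x hx
    have := h.loop_col i x hx
    have e : (l' i).conj * x * (l' i).conj⁻¹ = t (l i).col (l i).vert *
        ((l i).conj * x * (l i).conj⁻¹) * (t (l i).col (l i).vert)⁻¹ := by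
      simp only [l']; group
    rw [e, map_mul, map_mul, map_inv]
    exact mul_mem (mul_mem (ht _ _) this) (inv_mem (ht _ _))
  · intro u' hu' v' hv' a'
    rw [Finset.mem_erase] at hu' hv'
    have := (h.full u' hu'.2 v' hv'.2 a').transport
      (T := fun u v a => ∃ k, foldGen L J' l' k u v a) f π (by
        rintro u v a ⟨k', hr⟩
        have := ((hπt k' u).mul (hgen k' _ _ _ hr)).mul (hπt k' v).inv
        refine GroupoidClosure.mono (fun _ _ _ hr => ⟨k', hr⟩) ?_
        convert this using 1
        group)
    simpa [f, π, hu'.1, hv'.1] using this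

/-- Fold until a single vertex is left. -/
lemma IsFolding.exists_card_eq_one (n : ℕ) : ∀ {W : Finset ℕ} {J : Multiset (κ × ℕ × ℕ × A)}
    {l : E → EllLoop κ A}, IsFolding ψ L W J l → W.card = n + 1 →
    ∃ (w : ℕ) (J' : Multiset (κ × ℕ × ℕ × A)) (l' : E → EllLoop κ A),
      J'.card + n = J.card ∧ IsFolding ψ L {w} J' l' := by
  induction n with
  | zero =>
    intro W J l h hW
    obtain ⟨w, rfl⟩ := Finset.card_eq_one.1 hW
    exact ⟨w, J, l, by simp, h⟩
  | succ n ih =>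
    intro W J l h hW
    obtain ⟨x, hx, y, hy, hxy⟩ := Finset.one_lt_card.1 (show 1 < W.card by omega)
    obtain ⟨k, u, v, a, ha, ha1, huv⟩ := exists_tie h.gen_col hxy (h.full x hx y hy 1)
    obtain ⟨J₀, b, hcard, h', ha'⟩ := h.exists_edge huv ha
    obtain ⟨J', l', hc', h''⟩ := h'.merge huv ha' ha1
    have huW := (h'.mem_of_edge _ _ _ _ (Multiset.mem_cons_self _ _)).1
    obtain ⟨w, J'', l'', hc'', hf⟩ := ih h'' (by rw [Finset.card_erase_of_mem huW]; omega)
    exact ⟨w, J'', l'', by omega, hf⟩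

end Monoid.CoprodI

namespace Monoid.CoprodI

variable {κ : Type} {M : κ → Type} [∀ k, Group (M k)] {A : Type} {E : Type}

/-- The edges of a coloured labelled multigraph. -/
def edgeRel (J : Multiset (κ × ℕ × ℕ × A)) (u v : ℕ) (a : A) : Prop := ∃ k, (k, u, v, a) ∈ J

lemma edgeRel_mono {J J' : Multiset (κ × ℕ × ℕ × A)} (h : J ≤ J') (u v : ℕ) (a : A)
    (hr : edgeRel J u v a) : edgeRel J' u v a :=
  hr.imp fun _ hr => Multiset.mem_of_le h hr

variable [Group A]

/-- A tree of coloured labelled edges with root `0`. -/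
structure IsHair (ψ : A →* CoprodI M) (W : Finset ℕ) (J : Multiset (κ × ℕ × ℕ × A)) : Prop where
  zero_mem : 0 ∈ W
  mem_of_edge : ∀ k u v a, (k, u, v, a) ∈ J → u ∈ W ∧ v ∈ W
  edge_col : ∀ k u v a, (k, u, v, a) ∈ J → ψ a ∈ (of (M := M) (i := k)).range
  conn : ∀ w ∈ W, ∃ a, GroupoidClosure (edgeRel J) 0 w a
  card : J.card + 1 = W.card

variable {ψ : A →* CoprodI M}

lemma closure_letters [Nonempty κ] (hψ : Function.Surjective ψ) (a : A) :
    a ∈ Submonoid.closure {b : A | ∃ k, ψ b ∈ (of (M := M) (i := k)).range} := by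
  suffices ∀ (y : CoprodI M) (a : A), ψ a = y →
      a ∈ Submonoid.closure {b : A | ∃ k, ψ b ∈ (of (M := M) (i := k)).range} from this _ a rfl
  intro y
  induction y using CoprodI.induction_left with
  | one =>
    intro a ha
    exact Submonoid.subset_closure ⟨Classical.arbitrary κ, by rw [ha]; exact one_mem _⟩
  | mul m x ih =>
    intro a ha
    obtain ⟨b, hb⟩ := hψ (of m)
    have := ih (b⁻¹ * a) (by rw [map_mul, map_inv, ha, hb]; group)
    rw [← mul_inv_cancel_left b a]
    exact mul_mem (Submonoid.subset_closure ⟨_, m, hb.symm⟩) this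

lemma IsHair.exists_vertex [Nonempty κ] (hψ : Function.Surjective ψ) {W : Finset ℕ}
    {J : Multiset (κ × ℕ × ℕ × A)} (h : IsHair ψ W J) (a : A) :
    ∃ W' J', W ⊆ W' ∧ J ≤ J' ∧ IsHair ψ W' J' ∧
      ∃ v ∈ W', GroupoidClosure (edgeRel J') 0 v a := by
  induction closure_letters hψ a using Submonoid.closure_induction_right with
  | one => exact ⟨W, J, subset_rfl, le_rfl, h, 0, h.zero_mem, .one 0⟩
  | mul_right a _ b hb ih =>
    obtain ⟨k, hb⟩ := hb
    obtain ⟨W', J', hW, hJ, h', v, hv, ha⟩ := ih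
    obtain ⟨w, hw⟩ := Infinite.exists_notMem_finset W'
    have hm := edgeRel_mono (Multiset.le_cons_self J' (k, v, w, b))
    have hab := (ha.mono hm).mul (.gen ⟨k, Multiset.mem_cons_self _ _⟩)
    refine ⟨insert w W', (k, v, w, b) ::ₘ J', hW.trans (Finset.subset_insert _ _),
      hJ.trans (Multiset.le_cons_self _ _), ⟨?_, ?_, ?_, ?_, ?_⟩, w, Finset.mem_insert_self _ _, hab⟩
    · exact Finset.mem_insert_of_mem h'.zero_mem
    · intro k' u' v' a' hr
      rcases Multiset.mem_cons.1 hr with hr | hr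
      · simp only [Prod.mk.injEq] at hr
        obtain ⟨rfl, rfl, rfl, rfl⟩ := hr
        exact ⟨Finset.mem_insert_of_mem hv, Finset.mem_insert_self _ _⟩
      · exact (h'.mem_of_edge _ _ _ _ hr).imp Finset.mem_insert_of_mem Finset.mem_insert_of_mem
    · intro k' u' v' a' hr
      rcases Multiset.mem_cons.1 hr with hr | hr
      · simp only [Prod.mk.injEq] at hr
        obtain ⟨rfl, rfl, rfl, rfl⟩ := hr
        exact hb
      · exact h'.edge_col _ _ _ _ hr
    · intro x hx
      rcases Finset.mem_insert.1 hx with rfl | hx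
      · exact ⟨_, hab⟩
      · obtain ⟨c, hc⟩ := h'.conn x hx
        exact ⟨c, hc.mono hm⟩
    · rw [Multiset.card_cons, h'.card, Finset.card_insert_of_notMem hw]

lemma exists_isHair [Nonempty κ] (hψ : Function.Surjective ψ) {I : Type} (g : I → A)
    (s : Finset I) :
    ∃ W J, IsHair ψ W J ∧ ∀ i ∈ s, ∃ v ∈ W, GroupoidClosure (edgeRel J) 0 v (g i) := by
  classical
  induction s using Finset.induction_on with
  | empty =>
    refine ⟨{0}, 0, ⟨by simp, by simp, by simp, ?_, by simp⟩, by simp⟩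
    intro w hw
    rw [Finset.mem_singleton.1 hw]
    exact ⟨1, .one 0⟩
  | insert i s hi ih =>
    obtain ⟨W, J, h, hv⟩ := ih
    obtain ⟨W', J', hW, hJ, h', hv'⟩ := h.exists_vertex hψ (g i)
    refine ⟨W', J', h', ?_⟩
    intro j hj
    rcases Finset.mem_insert.1 hj with rfl | hj
    · exact hv'
    · obtain ⟨v, hv, hg⟩ := hv j hj
      exact ⟨v, hW hv, hg.mono (edgeRel_mono hJ)⟩

lemma exists_isFolding [Nonempty κ] (hψ : Function.Surjective ψ) [Finite E] {C : Type} [Fintype C]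
    (L : E → Subgroup A) (t : C → A)
    (hgen : ∀ K : Subgroup A, (∀ i, L i ≤ K) → (∀ j, t j ∈ K) → K = ⊤)
    (hell : ∀ i, ∃ k g, ∀ x ∈ L i, ψ (g⁻¹ * x * g) ∈ (of (M := M) (i := k)).range) :
    ∃ W J l, IsFolding ψ L W J l ∧ W.Nonempty ∧ J.card + 1 = Fintype.card C + W.card := by
  classical
  have := Fintype.ofFinite E
  choose k g hg using hell
  obtain ⟨W, J, h, hv⟩ := exists_isHair hψ (Sum.elim g t) Finset.univ
  choose v hvW hv using fun i => hv i (Finset.mem_univ i)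
  let J' : Multiset (κ × ℕ × ℕ × A) :=
    J + Finset.univ.val.map fun j : C => (Classical.arbitrary κ, v (Sum.inr j), 0, 1)
  let l : E → EllLoop κ A := fun i => ⟨v (Sum.inl i), k i, (g i)⁻¹⟩
  have hJ : J ≤ J' := Multiset.le_add_right _ _
  have hmem : ∀ e, e ∈ J' → e ∈ J ∨ ∃ j : C, (Classical.arbitrary κ, v (Sum.inr j), 0, 1) = e := by
    intro e he
    rcases Multiset.mem_add.1 he with he | he
    · exact Or.inl he
    · obtain ⟨j, -, hj⟩ := Multiset.mem_map.1 he
      exact Or.inr ⟨j, hj⟩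
  have hup : ∀ u v a, edgeRel J u v a → ∃ k, foldGen L J' l k u v a := fun u v a hr =>
    hr.imp fun _ hr => Or.inl (Multiset.mem_of_le hJ hr)
  refine ⟨W, J', l, ⟨?_, fun i => hvW _, ?_, ?_, ?_⟩, ⟨0, h.zero_mem⟩, ?_⟩
  · intro k u v a hr
    rcases hmem _ hr with hr | ⟨j, hj⟩
    · exact h.mem_of_edge _ _ _ _ hr
    · simp only [Prod.mk.injEq] at hj
      obtain ⟨rfl, rfl, rfl, rfl⟩ := hj
      exact ⟨hvW _, h.zero_mem⟩
  · intro k u v a hr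
    rcases hmem _ hr with hr | ⟨j, hj⟩
    · exact h.edge_col _ _ _ _ hr
    · simp only [Prod.mk.injEq] at hj
      obtain ⟨rfl, rfl, rfl, rfl⟩ := hj
      rw [map_one]; exact one_mem _
  · intro i x hx
    simp only [l, inv_inv]
    exact hg i x hx
  · have h0 : GroupoidClosure.vertexGroup (A := A) (fun u v a => ∃ k, foldGen L J' l k u v a) 0 = ⊤ := by
      apply hgen
      · intro i x hx
        rw [GroupoidClosure.mem_vertexGroup]
        have h1 := (hv (Sum.inl i)).mono hup
        have := (h1.mul (.gen ⟨k i, Or.inr ⟨i, rfl, rfl, rfl, x, hx, rfl⟩⟩)).mul h1.inv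
        convert this using 1
        simp only [Sum.elim_inl, l]
        group
      · intro j
        rw [GroupoidClosure.mem_vertexGroup]
        have h1 := (hv (Sum.inr j)).mono hup
        have := h1.mul (.gen (R := fun u v a => ∃ k, foldGen L J' l k u v a) (v := 0) (a := 1)
          ⟨Classical.arbitrary κ, Or.inl (Multiset.mem_add.2 (Or.inr
            (Multiset.mem_map.2 ⟨j, Finset.mem_univ j, rfl⟩)))⟩)
        simpa using this
    intro u hu v hv a
    obtain ⟨b, hb⟩ := h.conn u hu
    obtain ⟨c, hc⟩ := h.conn v hv
    have h1 : b * a * c⁻¹ ∈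
        GroupoidClosure.vertexGroup (A := A) (fun u v a => ∃ k, foldGen L J' l k u v a) 0 := by
      rw [h0]; trivial
    convert ((hb.mono hup).inv.mul h1).mul (hc.mono hup) using 1
    group
  · have := h.card
    simp only [J', Multiset.card_add, Multiset.card_map, Finset.card_val, Finset.card_univ]
    omega

/-- A version of Grushko's theorem: generating systems consisting of subgroups with elliptic image
and of elements can be adapted to a free product decomposition of a quotient. -/
theorem exists_adapted [Nonempty κ] (hψ : Function.Surjective ψ) [Finite E] {C : Type} [Finite C]
    (L : E → Subgroup A) (t : C → A)
    (hgen : ∀ K : Subgroup A, (∀ i, L i ≤ K) → (∀ j, t j ∈ K) → K = ⊤)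
    (hell : ∀ i, ∃ k g, ∀ x ∈ L i, ψ (g⁻¹ * x * g) ∈ (of (M := M) (i := k)).range) :
    ∃ (col : E → κ) (a : E → A) (col' : C → κ) (b : C → A),
      (∀ i, ∀ x ∈ L i, ψ (a i * x * (a i)⁻¹) ∈ (of (M := M) (i := col i)).range) ∧
      (∀ j, ψ (b j) ∈ (of (M := M) (i := col' j)).range) ∧
      ∀ K : Subgroup A, (∀ i, ∀ x ∈ L i, a i * x * (a i)⁻¹ ∈ K) → (∀ j, b j ∈ K) → K = ⊤ := by
  have := Fintype.ofFinite C
  obtain ⟨W, J, l, h, hW, hc⟩ := exists_isFolding hψ L t hgen hell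
  obtain ⟨w, J', l', hc', h'⟩ := h.exists_card_eq_one (W.card - 1)
    (by have := hW.card_pos; omega)
  have hcard : J'.card = Fintype.card C := by have := hW.card_pos; omega
  let e : C ≃ Fin J'.toList.length :=
    Fintype.equivFinOfCardEq (by rw [Multiset.length_toList, hcard])
  let b : C → κ × ℕ × ℕ × A := fun j => J'.toList.get (e j)
  have hb : ∀ j, b j ∈ J' := fun j => Multiset.mem_toList.1 (List.get_mem _ _)
  refine ⟨fun i => (l' i).col, fun i => (l' i).conj, fun j => (b j).1, fun j => (b j).2.2.2,
    h'.loop_col, fun j => h'.edge_col _ _ _ _ (hb j), ?_⟩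
  intro K hK hbK
  rw [eq_top_iff]
  intro a _
  have : ∀ u v a, GroupoidClosure (fun u v a => ∃ k, foldGen L J' l' k u v a) u v a → a ∈ K := by
    intro u v a hr
    induction hr with
    | gen hr =>
      obtain ⟨k, hr | ⟨i, -, -, -, x, hx, rfl⟩⟩ := hr
      · obtain ⟨n, hn⟩ := List.get_of_mem (Multiset.mem_toList.2 hr)
        have := hbK (e.symm n)
        simpa only [b, Equiv.apply_symm_apply, hn] using this
      · exact hK i x hx
    | one u => exact one_mem _
    | inv _ ih => exact inv_mem ih
    | mul _ _ ih₁ ih₂ => exact mul_mem ih₁ ih₂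
  exact this w w a (h'.full w (by simp) w (by simp) a)

end Monoid.CoprodI

namespace Monoid.CoprodI

lemma eq_top_of_forall_of_mem {ι : Type} {L : ι → Type} [∀ i, Group (L i)]
    {K : Subgroup (CoprodI L)} (h : ∀ i (x : L i), of x ∈ K) : K = ⊤ := by
  rw [eq_top_iff]
  rintro y -
  induction y using CoprodI.induction_on with
  | one => exact one_mem _
  | of i x => exact h i x
  | mul x y hx hy => exact mul_mem hx hy

section retract

variable {ι : Type} {L : ι → Type} [∀ i, Group (L i)]

open scoped Classical in
/-- The retraction of a free product onto one of its factors. -/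
noncomputable def retract (i : ι) : CoprodI L →* L i :=
  lift fun j => if h : j = i then h ▸ MonoidHom.id (L j) else 1

@[simp] lemma retract_of_same {i : ι} (x : L i) : retract i (of x) = x := by
  simp [retract]

lemma retract_of_ne {i j : ι} (h : j ≠ i) (x : L j) : retract i (of x) = 1 := by
  simp [retract, h]

lemma retract_of_mem_range {i j : ι} {x : CoprodI L} (hx : x ∈ (of (M := L) (i := j)).range)
    (h : j ≠ i) : retract i x = 1 := by
  obtain ⟨y, rfl⟩ := hx
  exact retract_of_ne h y

lemma of_retract {i : ι} {x : CoprodI L} (hx : x ∈ (of (M := L) (i := i)).range) :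
    of (retract i x) = x := by
  obtain ⟨y, rfl⟩ := hx
  rw [retract_of_same]

end retract

section rank

variable {I : Type} [Fintype I] [Nonempty I] {U : I → Type} [∀ i, Group (U i)]

/-- Grushko's theorem, in terms of numbers of generators. -/
theorem exists_generators_factors {C : Type} [Fintype C] (t : C → CoprodI U)
    (ht : Subgroup.closure (Set.range t) = ⊤) :
    ∃ s : ∀ i, Finset (U i), (∀ i, Subgroup.closure (s i : Set (U i)) = ⊤) ∧
      ∑ i, (s i).card ≤ Fintype.card C := by
  classical
  obtain ⟨_, _, col, b, _, hb, hgen⟩ := exists_adapted (ψ := MonoidHom.id (CoprodI U))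
    Function.surjective_id (fun i : Empty => i.elim) t
    (fun K _ hK => by
      rw [eq_top_iff, ← ht, Subgroup.closure_le]
      rintro _ ⟨j, rfl⟩
      exact hK j) (fun i => i.elim)
  refine ⟨fun i => (Finset.univ.filter fun j => col j = i).image fun j => retract i (b j), ?_, ?_⟩
  · intro i
    have h1 := hgen ((Subgroup.closure ((Finset.univ.filter fun j => col j = i).image
      fun j => retract i (b j) : Set (U i))).comap (retract i)) (fun i => i.elim) (by
        intro j
        rw [Subgroup.mem_comap]
        by_cases hj : col j = i
        · apply Subgroup.subset_closure
          rw [Finset.coe_image]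
          exact ⟨j, by simpa using hj, rfl⟩
        · rw [retract_of_mem_range (x := b j) (hb j) hj]
          exact one_mem _)
    rw [eq_top_iff]
    intro x _
    have : of x ∈ (⊤ : Subgroup (CoprodI U)) := trivial
    rw [← h1, Subgroup.mem_comap, retract_of_same] at this
    exact this
  · calc _ ≤ ∑ i, (Finset.univ.filter fun j => col j = i).card :=
        Finset.sum_le_sum fun i _ => Finset.card_image_le
      _ = Fintype.card C :=
        (Finset.card_eq_sum_card_fiberwise (s := Finset.univ) (t := Finset.univ) (f := col)
          (by simp)).symm

end rank

section colored

variable {ι κ : Type} {L : ι → Type} [∀ i, Group (L i)] {M : κ → Type} [∀ k, Group (M k)]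

/-- A homomorphism of free products mapping factors into factors. -/
def IsColored (g : CoprodI L →* CoprodI M) (τ : ι → κ) : Prop :=
  ∀ (i : ι) (x : L i), g (of x) ∈ (of (M := M) (i := τ i)).range

variable {g : CoprodI L →* CoprodI M} {τ : ι → κ}

lemma IsColored.map_eq_of_surjective (hg : IsColored g τ) (hs : Function.Surjective g) (k : κ) :
    (⨆ i : {i // τ i = k}, (of (M := L) (i := i.1)).range).map g =
      (of (M := M) (i := k)).range := by
  apply le_antisymm
  · rw [Subgroup.map_le_iff_le_comap, iSup_le_iff]
    rintro ⟨i, rfl⟩ _ ⟨x, rfl⟩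
    exact hg i x
  · rintro _ ⟨m, rfl⟩
    suffices ∀ y, of (retract k (g y)) ∈
        (⨆ i : {i // τ i = k}, (of (M := L) (i := i.1)).range).map g by
      obtain ⟨y, hy⟩ := hs (of m)
      have := this y
      rwa [hy, retract_of_same] at this
    intro y
    induction y using CoprodI.induction_on with
    | one => simp
    | of i x =>
      by_cases hi : τ i = k
      · subst hi
        rw [of_retract (hg i x)]
        exact Subgroup.mem_map_of_mem g (Subgroup.mem_iSup_of_mem ⟨i, rfl⟩ ⟨x, rfl⟩)
      · rw [retract_of_mem_range (hg i x) hi, map_one]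
        exact one_mem _
    | mul x y hx hy =>
      rw [map_mul, map_mul, map_mul]
      exact mul_mem hx hy

lemma IsColored.surjective_index (hg : IsColored g τ) (hs : Function.Surjective g)
    [∀ k, Nontrivial (M k)] : Function.Surjective τ := by
  intro k
  by_contra hk
  push Not at hk
  obtain ⟨m, hm⟩ := exists_ne (1 : M k)
  have h := hg.map_eq_of_surjective hs k
  have : IsEmpty {i // τ i = k} := ⟨fun i => hk i.1 i.2⟩
  rw [iSup_of_empty, Subgroup.map_bot] at h
  have h2 : of m ∈ (of (M := M) (i := k)).range := ⟨m, rfl⟩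
  rw [← h, Subgroup.mem_bot] at h2
  exact of_ne_one hm h2

lemma IsColored.map_range_of (hg : IsColored g τ) (hs : Function.Surjective g)
    (hτ : Function.Injective τ) (i : ι) :
    (of (M := L) (i := i)).range.map g = (of (M := M) (i := τ i)).range := by
  rw [← hg.map_eq_of_surjective hs]
  congr 1
  apply le_antisymm
  · exact le_iSup (fun j : {j // τ j = τ i} => (of (M := L) (i := j.1)).range) ⟨i, rfl⟩
  · rw [iSup_le_iff]
    rintro ⟨j, hj⟩
    obtain rfl := hτ hj
    exact le_rfl

lemma IsColored.injective (hg : IsColored g τ) (hτ : Function.Injective τ)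
    (h1 : ∀ i (x : L i), g (of x) = 1 → x = 1) : Function.Injective g := by
  suffices ∀ (i j : ι) (w : NeWord L i j), g w.prod ≠ 1 ∧ fstIdx (g w.prod) = some (τ i) ∧
      fstIdx (g w.prod)⁻¹ = some (τ j) from injective_of_neWord g fun i j w => (this i j w).1
  intro i j w
  induction w with
  | @singleton i x hx =>
    rw [NeWord.prod_singleton]
    have hne : g (of x) ≠ 1 := fun h => hx (h1 i x h)
    obtain ⟨y, hy⟩ := hg i x
    rw [← hy] at hne ⊢
    have hy1 : y ≠ 1 := by
      rintro rfl
      exact hne (map_one _)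
    exact ⟨hne, fstIdx_of hy1, by rw [← map_inv, fstIdx_of (inv_ne_one.2 hy1)]⟩
  | append w₁ hne w₂ ih₁ ih₂ =>
    rw [NeWord.append_prod, map_mul]
    obtain ⟨a1, a2, a3⟩ := ih₁
    obtain ⟨b1, b2, b3⟩ := ih₂
    have hne' : ∀ {i j : ι}, i ≠ j → some (τ i) ≠ some (τ j) := fun h h' =>
      h (hτ (Option.some_injective _ h'))
    have := reduced_mul a1 b1 (by rw [a3, b2]; exact hne' hne)
    refine ⟨this.1, this.2.1.trans a2, ?_⟩
    rw [mul_inv_rev, fstIdx_mul (inv_ne_one.2 b1), b3]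
    rw [inv_inv, b2, a3]
    exact hne' hne.symm

open scoped Classical in
/-- A surjection between free products all of whose factors are infinite cyclic or have
elliptic image can be made to respect the factors. -/
theorem exists_isColored [Nonempty κ] [Finite ι] (hs : Function.Surjective g) (C : ι → Prop)
    (hC : ∀ i, C i → Nonempty (L i ≃* Multiplicative ℤ))
    (hE : ∀ i, ¬ C i → IsElliptic (g.comp (of (M := L) (i := i))).range) :
    ∃ (f : CoprodI L →* CoprodI L) (τ : ι → κ), Function.Surjective f ∧
      IsColored (g.comp f) τ ∧
      ∀ i, ¬ C i → ∃ a, ∀ x : L i, f (of x) = a * of x * a⁻¹ := by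
  have e : ∀ i, C i → L i ≃* Multiplicative ℤ := fun i h => (hC i h).some
  let t : {i // C i} → CoprodI L := fun i => of ((e i.1 i.2).symm (Multiplicative.ofAdd 1))
  have he : ∀ i (h : C i) (x : L i),
      x = ((e i h).symm (Multiplicative.ofAdd 1)) ^ (Multiplicative.toAdd (e i h x)) := by
    intro i h x
    rw [← map_zpow, ← ofAdd_zsmul, smul_eq_mul, mul_one, ofAdd_toAdd, MulEquiv.symm_apply_apply]
  obtain ⟨col, a, col', b, h1, h2, h3⟩ := exists_adapted (ψ := g) (E := {i // ¬ C i}) hs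
    (fun i => (of (M := L) (i := i.1)).range) t (by
      intro K hK ht
      refine eq_top_of_forall_of_mem fun i x => ?_
      by_cases h : C i
      · rw [he i h x, map_zpow]
        exact zpow_mem (ht ⟨i, h⟩) _
      · exact hK ⟨i, h⟩ ⟨x, rfl⟩) (by
      rintro ⟨i, hi⟩
      obtain ⟨k, y, hy⟩ := hE i hi
      obtain ⟨y, rfl⟩ := hs y
      refine ⟨k, y, ?_⟩
      rintro _ ⟨x, rfl⟩
      rw [map_mul, map_mul, map_inv]
      exact hy _ ⟨x, rfl⟩)
  let f : CoprodI L →* CoprodI L := lift fun i =>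
    if h : C i then (zpowersHom _ (b ⟨i, h⟩)).comp (e i h).toMonoidHom
    else (MulAut.conj (a ⟨i, h⟩)).toMonoidHom.comp of
  have hfC : ∀ i (h : C i) (x : L i), f (of x) = b ⟨i, h⟩ ^ Multiplicative.toAdd (e i h x) := by
    intro i h x
    simp only [f, lift_of, h, dif_pos]
    exact zpowersHom_apply _ _ _
  have hfE : ∀ i (h : ¬ C i) (x : L i), f (of x) = a ⟨i, h⟩ * of x * (a ⟨i, h⟩)⁻¹ := by
    intro i h x
    simp only [f, lift_of, h, dif_neg, not_false_eq_true]
    rfl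
  let τ : ι → κ := fun i => if h : C i then col' ⟨i, h⟩ else col ⟨i, h⟩
  refine ⟨f, τ, ?_, ?_, ?_⟩
  · rw [← MonoidHom.range_eq_top]
    apply h3
    · rintro ⟨i, hi⟩ _ ⟨x, rfl⟩
      exact ⟨of x, hfE i hi x⟩
    · rintro ⟨i, hi⟩
      refine ⟨t ⟨i, hi⟩, ?_⟩
      rw [hfC i hi, MulEquiv.apply_symm_apply, toAdd_ofAdd, zpow_one]
  · intro i x
    by_cases h : C i
    · rw [show τ i = col' ⟨i, h⟩ from dif_pos h, MonoidHom.comp_apply, hfC i h, map_zpow]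
      exact zpow_mem (h2 ⟨i, h⟩) _
    · rw [show τ i = col ⟨i, h⟩ from dif_neg h, MonoidHom.comp_apply, hfE i h]
      exact h1 ⟨i, h⟩ _ ⟨x, rfl⟩
  · intro i h
    exact ⟨_, hfE i h⟩

end colored

/-- A free product of nontrivial groups has at most as many factors as generators. -/
lemma card_le_of_closure_eq_top {ι : Type} [Fintype ι] {L : ι → Type} [∀ i, Group (L i)]
    [∀ i, Nontrivial (L i)] {C : Type} [Fintype C] (t : C → CoprodI L)
    (ht : Subgroup.closure (Set.range t) = ⊤) : Fintype.card ι ≤ Fintype.card C := by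
  rcases isEmpty_or_nonempty ι with h | h
  · simp
  obtain ⟨s, hs, hc⟩ := exists_generators_factors t ht
  refine le_trans ?_ hc
  rw [Fintype.card_eq_sum_ones]
  refine Finset.sum_le_sum fun i _ => ?_
  by_contra hlt
  have h0 : s i = ∅ := Finset.card_eq_zero.1 (by omega)
  have := hs i
  rw [h0, Finset.coe_empty, Subgroup.closure_empty] at this
  exact bot_ne_top this

open scoped Classical in
/-- The weight of a free factor. -/
noncomputable def factorWeight (n : ℕ) (X : Type) [Group X] : ℕ :=
  n + 1 + if Nonempty (X ≃* Multiplicative ℤ) then 1 else 0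

/-- A family of groups indexed by a sum type. -/
instance sumElimGroup {I J : Type} (X : I → Type) (Y : J → Type) [∀ i, Group (X i)]
    [∀ j, Group (Y j)] : ∀ s : I ⊕ J, Group (Sum.elim X Y s)
  | .inl i => inferInstanceAs (Group (X i))
  | .inr j => inferInstanceAs (Group (Y j))

section maximal

/-- The free product of the `L i` has maximal weight among those which are quotients of `G` and
have `G` as a quotient. -/
def IsMaximalFactorization (G : Type) [Group G] (n : ℕ) {ι : Type} [Fintype ι] (L : ι → Type)
    [∀ i, Group (L i)] : Prop :=
  ∀ (ι' : Type) [Fintype ι'] (L' : ι' → Type) [∀ i, Group (L' i)] [∀ i, Nontrivial (L' i)]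
    (α : G →* CoprodI L') (β : CoprodI L' →* G), Function.Surjective α → Function.Surjective β →
    ∑ i, factorWeight n (L' i) ≤ ∑ i, factorWeight n (L i)

lemma exists_isMaximalFactorization {κ : Type} [Fintype κ] (M : κ → Type) [∀ k, Group (M k)]
    [∀ k, Nontrivial (M k)] {C : Type} [Fintype C] (t : C → CoprodI M)
    (ht : Subgroup.closure (Set.range t) = ⊤) (n : ℕ) :
    ∃ (ι : Type) (_ : Fintype ι) (L : ι → Type) (_ : ∀ i, Group (L i)) (_ : ∀ i, Nontrivial (L i))
      (α : CoprodI M →* CoprodI L) (β : CoprodI L →* CoprodI M), Function.Surjective α ∧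
      Function.Surjective β ∧ IsMaximalFactorization (CoprodI M) n L := by
  let P : ℕ → Prop := fun v => ∃ (ι : Type) (_ : Fintype ι) (L : ι → Type) (_ : ∀ i, Group (L i))
    (_ : ∀ i, Nontrivial (L i)) (α : CoprodI M →* CoprodI L) (β : CoprodI L →* CoprodI M),
      Function.Surjective α ∧ Function.Surjective β ∧ ∑ i, factorWeight n (L i) = v
  have hP : ∀ v, P v → v ≤ Fintype.card C * (n + 2) := by
    rintro v ⟨ι, _, L, _, _, α, β, hα, hβ, rfl⟩
    have h1 := card_le_of_closure_eq_top (α ∘ t) (by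
      rw [Set.range_comp, ← MonoidHom.map_closure, ht, Subgroup.map_top_of_surjective _ hα])
    calc ∑ i, factorWeight n (L i) ≤ ∑ _i : ι, (n + 2) := Finset.sum_le_sum fun i _ => by
          unfold factorWeight
          split_ifs <;> omega
      _ ≤ _ := by
        rw [Finset.sum_const, smul_eq_mul]
        exact Nat.mul_le_mul_right _ h1
  classical
  have h0 : P (∑ k, factorWeight n (M k)) := ⟨κ, inferInstance, M, inferInstance, inferInstance,
    MonoidHom.id _, MonoidHom.id _, Function.surjective_id, Function.surjective_id, rfl⟩
  have hmax := Nat.findGreatest_spec (hP _ h0) h0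
  obtain ⟨ι, hι, L, hL, hL', α, β, hα, hβ, hv⟩ := hmax
  refine ⟨ι, hι, L, hL, hL', α, β, hα, hβ, ?_⟩
  intro ι' _ L' _ _ α' β' hα' hβ'
  rw [hv]
  have h1 : P (∑ i, factorWeight n (L' i)) :=
    ⟨ι', inferInstance, L', inferInstance, inferInstance, α', β', hα', hβ', rfl⟩
  exact Nat.le_findGreatest (hP _ h1) h1

variable {G : Type} [Group G] {n : ℕ} {ι : Type} [Fintype ι] {L : ι → Type}
  [∀ i, Group (L i)] [∀ i, Nontrivial (L i)]

/-- The image of a factor of a maximal factorization has no free product quotient of larger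
weight which maps back onto it. -/
lemma IsMaximalFactorization.sum_le (hL : IsMaximalFactorization G n L)
    {α : G →* CoprodI L} (hα : Function.Surjective α) {K : Type} [Group K] {γ : CoprodI L →* K}
    (hγ : Function.Surjective γ) {δ : K →* G} (hδ : Function.Surjective δ) (i : ι)
    {κ' : Type} [Fintype κ'] (P : κ' → Type) [∀ k, Group (P k)] [∀ k, Nontrivial (P k)]
    (a : (γ.comp (of (M := L) (i := i))).range →* CoprodI P) (ha : Function.Surjective a)
    (b : CoprodI P →* (γ.comp (of (M := L) (i := i))).range) (hb : Function.Surjective b) :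
    ∑ k, factorWeight n (P k) ≤ factorWeight n (L i) := by
  classical
  let L' : {j // j ≠ i} ⊕ κ' → Type := Sum.elim (fun j => L j.1) P
  have : ∀ s, Nontrivial (L' s) := by
    rintro (j | k)
    · exact inferInstanceAs (Nontrivial (L j.1))
    · exact inferInstanceAs (Nontrivial (P k))
  let ofl : ∀ j : {j // j ≠ i}, L j.1 →* CoprodI L' := fun j => of (M := L') (i := Sum.inl j)
  let ofr : ∀ k : κ', P k →* CoprodI L' := fun k => of (M := L') (i := Sum.inr k)
  let A : ∀ j : ι, L j →* CoprodI L' := fun j =>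
    if h : j ≠ i then ofl ⟨j, h⟩
    else (lift ofr).comp (a.comp ((γ.comp (of (M := L) (i := i))).rangeRestrict.comp
      ((not_not.1 h) ▸ MonoidHom.id (L j))))
  have hA1 : ∀ j (h : j ≠ i), A j = ofl ⟨j, h⟩ := fun j h => dif_pos h
  have hA2 : A i = (lift ofr).comp (a.comp ((γ.comp (of (M := L) (i := i))).rangeRestrict)) := by
    simp only [A, ne_eq, not_true_eq_false, dif_neg, not_false_eq_true]
    rfl
  have hAs : Function.Surjective (lift A) := by
    rw [← MonoidHom.range_eq_top]
    refine eq_top_of_forall_of_mem ?_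
    rintro (j | k) x
    · exact ⟨of (show L j.1 from x), by rw [lift_of, hA1 j.1 j.2]; rfl⟩
    · obtain ⟨y, hy⟩ := ha (of (show P k from x))
      obtain ⟨z, rfl⟩ := (γ.comp (of (M := L) (i := i))).rangeRestrict_surjective y
      refine ⟨of z, ?_⟩
      rw [lift_of, hA2, MonoidHom.comp_apply, MonoidHom.comp_apply, hy, lift_of]
      rfl
  let B : ∀ s, L' s →* K := fun s => match s with
    | .inl j => γ.comp (of (M := L) (i := j.1))
    | .inr k => ((γ.comp (of (M := L) (i := i))).range.subtype.comp b).comp (of (M := P) (i := k))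
  have hBr : ∀ y : CoprodI P, (b y : K) ∈ (lift B).range := by
    intro y
    induction y using CoprodI.induction_on with
    | one => rw [map_one]; exact one_mem _
    | of k x => exact ⟨ofr k x, lift_of _ _⟩
    | mul x y hx hy => rw [map_mul]; exact mul_mem hx hy
  have hBs : Function.Surjective (lift B) := by
    have h : (lift B).range.comap γ = ⊤ := by
      refine eq_top_of_forall_of_mem fun j x => ?_
      rw [Subgroup.mem_comap]
      by_cases h : j = i
      · subst h
        obtain ⟨y, hy⟩ := hb ⟨γ (of x), x, rfl⟩
        have := hBr y
        rwa [hy] at this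
      · exact ⟨ofl ⟨j, h⟩ x, lift_of _ _⟩
    intro y
    obtain ⟨x, rfl⟩ := hγ y
    have hx : x ∈ (lift B).range.comap γ := by rw [h]; trivial
    exact hx
  have key := hL _ L' ((lift A).comp α) (δ.comp (lift B)) (hAs.comp hα) (hδ.comp hBs)
  rw [Fintype.sum_sum_type, Fintype.sum_eq_add_sum_subtype_ne _ i, add_comm] at key
  exact Nat.le_of_add_le_add_right key

/-- The image of a factor which is not infinite cyclic is not infinite cyclic. -/
lemma IsMaximalFactorization.not_nonempty_mulEquiv (hL : IsMaximalFactorization G n L)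
    {α : G →* CoprodI L} (hα : Function.Surjective α) {K : Type} [Group K] {γ : CoprodI L →* K}
    (hγ : Function.Surjective γ) {δ : K →* G} (hδ : Function.Surjective δ) {i : ι}
    (hi : ¬ Nonempty (L i ≃* Multiplicative ℤ)) :
    ¬ Nonempty ((γ.comp (of (M := L) (i := i))).range ≃* Multiplicative ℤ) := by
  rintro ⟨e⟩
  have h : ∀ x : CoprodI fun _ : Unit => Multiplicative ℤ, ∃ z, of (i := ()) z = x := by
    intro x
    have : (of (M := fun _ : Unit => Multiplicative ℤ) (i := ())).range = ⊤ :=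
      eq_top_of_forall_of_mem fun i x => ⟨x, rfl⟩
    exact (this ▸ Subgroup.mem_top x : x ∈ (of (M := fun _ : Unit => Multiplicative ℤ)
      (i := ())).range)
  have := hL.sum_le hα hγ hδ i (fun _ : Unit => Multiplicative ℤ)
    ((of (i := ())).comp e.toMonoidHom) (by
      intro x
      obtain ⟨z, rfl⟩ := h x
      exact ⟨e.symm z, by simp⟩) (lift fun _ => e.symm.toMonoidHom) (by
      intro x
      exact ⟨of (i := ()) (e x), by simp⟩)
  have h1 : Nonempty (Multiplicative ℤ ≃* Multiplicative ℤ) := ⟨MulEquiv.refl _⟩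
  simp only [Finset.univ_unique, Finset.sum_singleton, factorWeight, hi, h1, if_true,
    if_false] at this
  omega

/-- The image of a factor which is not infinite cyclic is elliptic. -/
lemma IsMaximalFactorization.isElliptic (hL : IsMaximalFactorization G n L)
    {α : G →* CoprodI L} (hα : Function.Surjective α) {κ : Type} [Nonempty κ] {M : κ → Type}
    [∀ k, Group (M k)] {γ : CoprodI L →* CoprodI M}
    (hγ : Function.Surjective γ) {δ : CoprodI M →* G} (hδ : Function.Surjective δ) {i : ι}
    (hi : ¬ Nonempty (L i ≃* Multiplicative ℤ)) :
    IsElliptic (γ.comp (of (M := L) (i := i))).range := by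
  rcases isElliptic_or_splits (γ.comp (of (M := L) (i := i))).range with h | h | ⟨P, hP, ⟨e⟩⟩
  · exact h
  · exact absurd h (hL.not_nonempty_mulEquiv hα hγ hδ hi)
  · exfalso
    have := hL.sum_le hα hγ hδ i (fun b => P b) e.toMonoidHom e.surjective
      e.symm.toMonoidHom e.symm.surjective
    simp only [Fintype.sum_bool, factorWeight, hi, if_false] at this
    omega

end maximal

end Monoid.CoprodI

lemma injective_of_surjective_of_int {X Y : Type} [Group X] [Group Y]
    (eX : X ≃* Multiplicative ℤ) (eY : Y ≃* Multiplicative ℤ) (g : X →* Y)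
    (hg : Function.Surjective g) : Function.Injective g := by
  let h : ℤ →+ ℤ := MonoidHom.toAdditive
    ((eY.toMonoidHom.comp g).comp eX.symm.toMonoidHom)
  have hs : Function.Surjective h := (eY.surjective.comp hg).comp eX.symm.surjective
  have hi : Function.Injective h :=
    IsNoetherian.injective_of_surjective_endomorphism h.toIntLinearMap hs
  intro x y hxy
  have h1 : h (Multiplicative.toAdd (eX x)) = h (Multiplicative.toAdd (eX y)) := by
    change eY (g (eX.symm (eX x))) = eY (g (eX.symm (eX y)))
    rw [MulEquiv.symm_apply_apply, MulEquiv.symm_apply_apply, hxy]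
  exact eX.injective (hi h1)

namespace Monoid.CoprodI

section hopf

variable {G : Type} [Group G] {n : ℕ} {ι : Type} [Fintype ι] [Nonempty ι] {L : ι → Type}
  [∀ i, Group (L i)] [∀ i, Nontrivial (L i)]

lemma IsMaximalFactorization.exists_perm (hL : IsMaximalFactorization G n L)
    {α : G →* CoprodI L} (hα : Function.Surjective α) {β : CoprodI L →* G}
    (hβ : Function.Surjective β) {ψ : CoprodI L →* CoprodI L} (hψ : Function.Surjective ψ) :
    ∃ (f : CoprodI L →* CoprodI L) (σ : Equiv.Perm ι), Function.Surjective f ∧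
      IsColored (ψ.comp f) σ ∧
      (∀ i, ¬ Nonempty (L i ≃* Multiplicative ℤ) →
        ∃ a, ∀ x : L i, f (of x) = a * of x * a⁻¹) ∧
      ∀ i, Nonempty (L (σ i) ≃* Multiplicative ℤ) ↔ Nonempty (L i ≃* Multiplicative ℤ) := by
  obtain ⟨f, τ, hf, hc, ha⟩ := exists_isColored hψ
    (fun i => Nonempty (L i ≃* Multiplicative ℤ)) (fun _ h => h)
    (fun i hi => hL.isElliptic hα hψ hβ hi)
  have hbij : Function.Bijective τ :=
    Finite.surjective_iff_bijective.1 (hc.surjective_index (hψ.comp hf))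
  have key : ∀ i, ¬ Nonempty (L i ≃* Multiplicative ℤ) →
      ¬ Nonempty (L (τ i) ≃* Multiplicative ℤ) := by
    rintro i hi ⟨e⟩
    refine hL.not_nonempty_mulEquiv hα (γ := ψ.comp f) (hψ.comp hf) hβ hi ⟨?_⟩
    have h := hc.map_range_of (hψ.comp hf) hbij.1 i
    rw [← MonoidHom.range_comp] at h
    exact (MulEquiv.subgroupCongr h).trans
      ((MonoidHom.ofInjective (of_injective (M := L) (τ i))).symm.trans e)
  refine ⟨f, Equiv.ofBijective τ hbij, hf, hc, ha, fun i => ⟨fun h => ?_, fun h => ?_⟩⟩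
  · by_contra hi
    exact key i hi h
  · by_contra hi
    have := Equiv.Perm.perm_symm_on_of_perm_on_finite (f := Equiv.ofBijective τ hbij)
      (p := fun i => ¬ Nonempty (L i ≃* Multiplicative ℤ)) key hi
    rw [Equiv.symm_apply_apply] at this
    exact this h

/-- Some power of a surjection preserves the conjugacy classes of the factors which are not
infinite cyclic. -/
lemma IsMaximalFactorization.exists_comp (hL : IsMaximalFactorization G n L)
    {α : G →* CoprodI L} (hα : Function.Surjective α) {β : CoprodI L →* G}
    (hβ : Function.Surjective β) {ψ : CoprodI L →* CoprodI L} (hψ : Function.Surjective ψ) :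
    ∃ χ : CoprodI L →* CoprodI L, Function.Surjective χ ∧
      ∀ i, ¬ Nonempty (L i ≃* Multiplicative ℤ) → ∃ c : CoprodI L,
        (of (M := L) (i := i)).range.map (χ.comp ψ) =
          (of (M := L) (i := i)).range.map (MulAut.conj c).toMonoidHom := by
  obtain ⟨f, σ, hf, hc, ha, hσ⟩ := hL.exists_perm hα hβ hψ
  have h1 : ∀ i, ¬ Nonempty (L i ≃* Multiplicative ℤ) → ∃ c : CoprodI L,
        (of (M := L) (i := i)).range.map ψ =
          (of (M := L) (i := σ i)).range.map (MulAut.conj c).toMonoidHom := by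
    intro i hi
    obtain ⟨a, ha⟩ := ha i hi
    refine ⟨ψ a⁻¹, ?_⟩
    rw [← hc.map_range_of (hψ.comp hf) σ.injective i, Subgroup.map_map, ← MonoidHom.range_comp,
      ← MonoidHom.range_comp]
    congr 1
    ext x
    simp [ha]
    group
  have h2 : ∀ r : ℕ, ∃ χ : CoprodI L →* CoprodI L, Function.Surjective χ ∧
      ∀ i, ¬ Nonempty (L i ≃* Multiplicative ℤ) → ∃ c : CoprodI L,
        (of (M := L) (i := i)).range.map (χ.comp ψ) =
          (of (M := L) (i := (σ ^ (r + 1)) i)).range.map (MulAut.conj c).toMonoidHom := by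
    intro r
    induction r with
    | zero => exact ⟨MonoidHom.id _, Function.surjective_id, fun i hi => by
        rw [zero_add, pow_one, MonoidHom.id_comp]
        exact h1 i hi⟩
    | succ r ih =>
      obtain ⟨χ, hχ, h⟩ := ih
      refine ⟨ψ.comp χ, hψ.comp hχ, fun i hi => ?_⟩
      obtain ⟨c, hc⟩ := h i hi
      have hr : ∀ r : ℕ, ¬ Nonempty (L ((σ ^ r) i) ≃* Multiplicative ℤ) := by
        intro r
        induction r with
        | zero => exact hi
        | succ r ih => rwa [pow_succ', Equiv.Perm.mul_apply, hσ]
      obtain ⟨d, hd⟩ := h1 _ (hr (r + 1))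
      refine ⟨ψ c * d, ?_⟩
      rw [pow_succ' σ (r + 1), Equiv.Perm.mul_apply, MonoidHom.comp_assoc, ← Subgroup.map_map, hc,
        Subgroup.map_map]
      have e1 : ψ.comp (MulAut.conj c).toMonoidHom =
          (MulAut.conj (ψ c)).toMonoidHom.comp ψ := by
        ext x
        simp
      rw [e1, ← Subgroup.map_map, hd, Subgroup.map_map]
      congr 1
      ext x
      simp
  obtain ⟨χ, hχ, h⟩ := h2 (orderOf σ - 1)
  refine ⟨χ, hχ, fun i hi => ?_⟩
  have := h i hi
  rwa [Nat.sub_add_cancel (orderOf_pos σ), pow_orderOf_eq_one] at this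

lemma IsMaximalFactorization.injective_of_conj (hL : IsMaximalFactorization G n L)
    {α : G →* CoprodI L} (hα : Function.Surjective α) {β : CoprodI L →* G}
    (hβ : Function.Surjective β) {ψ : CoprodI L →* CoprodI L} (hψ : Function.Surjective ψ)
    (hconj : ∀ i, ¬ Nonempty (L i ≃* Multiplicative ℤ) →
      ∃ c, ∀ x : L i, ψ (of x) = c * of x * c⁻¹) : Function.Injective ψ := by
  obtain ⟨f, σ, hf, hc, ha, hσ⟩ := hL.exists_perm hα hβ hψ
  have h : Function.Injective (ψ.comp f) := by
    refine hc.injective σ.injective fun i x hx => ?_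
    by_cases hi : Nonempty (L i ≃* Multiplicative ℤ)
    · obtain ⟨e⟩ := hi
      obtain ⟨e'⟩ := (hσ i).2 ⟨e⟩
      have := injective_of_surjective_of_int e e' ((retract (σ i)).comp ((ψ.comp f).comp of)) (by
        intro y
        have hy : of y ∈ (of (M := L) (i := σ i)).range := ⟨y, rfl⟩
        rw [← hc.map_range_of (hψ.comp hf) σ.injective i] at hy
        obtain ⟨_, ⟨x, rfl⟩, hx⟩ := hy
        refine ⟨x, ?_⟩
        rw [MonoidHom.comp_apply, MonoidHom.comp_apply, hx, retract_of_same])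
      apply this
      rw [MonoidHom.comp_apply, MonoidHom.comp_apply, hx, map_one, map_one]
    · obtain ⟨a, ha⟩ := ha i hi
      obtain ⟨c, hc⟩ := hconj i hi
      rw [MonoidHom.comp_apply, ha, map_mul, map_mul, map_inv, hc, mul_inv_eq_one,
        mul_eq_left, mul_inv_eq_one, mul_eq_left] at hx
      exact of_injective i (hx.trans (map_one _).symm)
  intro x y hxy
  obtain ⟨x, rfl⟩ := hf x
  obtain ⟨y, rfl⟩ := hf y
  rw [h hxy]

end hopf

/-- A finitely generated free product of finitely many Hopfian groups is Hopfian. -/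
theorem injective_of_surjective {κ : Type} [Fintype κ] [Nonempty κ] {M : κ → Type}
    [∀ k, Group (M k)] [∀ k, Nontrivial (M k)] {C : Type} [Fintype C] (t : C → CoprodI M)
    (ht : Subgroup.closure (Set.range t) = ⊤)
    (hM : ∀ k (f : M k →* M k), Function.Surjective f → Function.Injective f)
    (φ : CoprodI M →* CoprodI M) (hφ : Function.Surjective φ) : Function.Injective φ := by
  obtain ⟨ι, _, L, _, _, α₀, β, hα₀, hβ, hL⟩ := exists_isMaximalFactorization M t ht 0
  suffices H : ∀ α : CoprodI M →* CoprodI L, Function.Surjective α → Function.Injective α by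
    have := H (α₀.comp φ) (hα₀.comp hφ)
    rw [MonoidHom.coe_comp] at this
    exact this.of_comp
  intro α hα
  rcases isEmpty_or_nonempty ι with hι | hι
  · have h1 : (⊥ : Subgroup (CoprodI L)) = ⊤ := eq_top_of_forall_of_mem fun i => hι.elim i
    have h2 : ∀ x : CoprodI M, x = 1 := by
      intro x
      obtain ⟨y, rfl⟩ := hβ x
      have : y ∈ (⊥ : Subgroup (CoprodI L)) := h1 ▸ Subgroup.mem_top y
      rw [Subgroup.mem_bot.1 this, map_one]
    intro x y _
    rw [h2 x, h2 y]
  obtain ⟨f, τ, hf, hc, -⟩ := exists_isColored hβ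
    (fun i => Nonempty (L i ≃* Multiplicative ℤ)) (fun _ h => h)
    (fun i hi => hL.isElliptic hα hβ (δ := MonoidHom.id _) Function.surjective_id hi)
  set β₁ := β.comp f with hβ₁
  have hβ₁s : Function.Surjective β₁ := hβ.comp hf
  obtain ⟨χ, hχ, hcomp⟩ := hL.exists_comp hα hβ (ψ := α.comp β₁) (hα.comp hβ₁s)
  choose! c hcc using hcomp
  let α₁ := χ.comp α
  have hα₁ : Function.Surjective α₁ := hχ.comp hα
  let ψ₁ := α₁.comp β₁
  have hψ₁ : Function.Surjective ψ₁ := hα₁.comp hβ₁s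
  classical
  let Ψ : CoprodI L →* CoprodI L := lift fun i =>
    if Nonempty (L i ≃* Multiplicative ℤ) then ψ₁.comp of
    else (MulAut.conj (c i)).toMonoidHom.comp of
  have hΨr : ∀ i, (of (M := L) (i := i)).range.map Ψ = (of (M := L) (i := i)).range.map ψ₁ := by
    intro i
    by_cases hi : Nonempty (L i ≃* Multiplicative ℤ)
    · rw [← MonoidHom.range_comp, ← MonoidHom.range_comp]
      congr 1
      ext x
      rw [MonoidHom.comp_apply, lift_of, if_pos hi]
    · have e : ψ₁ = χ.comp (α.comp β₁) := rfl
      rw [e, hcc i hi, ← MonoidHom.range_comp, ← MonoidHom.range_comp]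
      congr 1
      ext x
      rw [MonoidHom.comp_apply, lift_of, if_neg hi]
  have hΨs : Function.Surjective Ψ := by
    rw [← MonoidHom.range_eq_top, eq_top_iff, ← MonoidHom.range_eq_top.2 hψ₁, MonoidHom.range_eq_map,
      MonoidHom.range_eq_map, Subgroup.map_le_iff_le_comap, top_le_iff]
    refine eq_top_of_forall_of_mem fun i x => ?_
    have : ψ₁ (of x) ∈ (of (M := L) (i := i)).range.map ψ₁ := ⟨_, ⟨x, rfl⟩, rfl⟩
    rw [← hΨr] at this
    exact Subgroup.map_mono le_top this
  have hΨi : Function.Injective Ψ := by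
    refine hL.injective_of_conj hα hβ hΨs fun i hi => ⟨c i, fun x => ?_⟩
    rw [lift_of, if_neg hi]
    rfl
  let Ψe := MulEquiv.ofBijective Ψ ⟨hΨi, hΨs⟩
  let θ : CoprodI M →* CoprodI M := (β₁.comp Ψe.symm.toMonoidHom).comp α₁
  have hθ : ∀ k, (of (M := M) (i := k)).range.map θ = (of (M := M) (i := k)).range := by
    intro k
    have e1 := hc.map_eq_of_surjective hβ₁s k
    have e2 : (⨆ i : {i // τ i = k}, (of (M := L) (i := i.1)).range).map (α₁.comp β₁) =
        (⨆ i : {i // τ i = k}, (of (M := L) (i := i.1)).range).map Ψ := by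
      rw [Subgroup.map_iSup, Subgroup.map_iSup]
      exact iSup_congr fun i => (hΨr i.1).symm
    calc (of (M := M) (i := k)).range.map θ
        = (⨆ i : {i // τ i = k}, (of (M := L) (i := i.1)).range).map (θ.comp β₁) := by
          rw [← Subgroup.map_map _ θ β₁, e1]
      _ = ((⨆ i : {i // τ i = k}, (of (M := L) (i := i.1)).range).map (α₁.comp β₁)).map
            (β₁.comp Ψe.symm.toMonoidHom) := by
          rw [Subgroup.map_map]
          rfl
      _ = (⨆ i : {i // τ i = k}, (of (M := L) (i := i.1)).range).map β₁ := by
          rw [e2, Subgroup.map_map]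
          congr 1
          ext i x
          change β₁ (Ψe.symm (Ψe (of x))) = _
          rw [MulEquiv.symm_apply_apply]
          rfl
      _ = _ := e1
  have hθm : ∀ k (x : M k), θ (of x) ∈ (of (M := M) (i := k)).range := by
    intro k x
    rw [← hθ k]
    exact ⟨_, ⟨x, rfl⟩, rfl⟩
  have hθi : Function.Injective θ := by
    refine IsColored.injective (τ := id) hθm Function.injective_id fun k x hx => ?_
    have := hM k ((retract k).comp (θ.comp of)) (by
      intro y
      have hy : of y ∈ (of (M := M) (i := k)).range := ⟨y, rfl⟩
      rw [← hθ k] at hy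
      obtain ⟨_, ⟨x, rfl⟩, hx⟩ := hy
      refine ⟨x, ?_⟩
      rw [MonoidHom.comp_apply, MonoidHom.comp_apply, hx, retract_of_same])
    apply this
    rw [MonoidHom.comp_apply, MonoidHom.comp_apply, hx, map_one, map_one]
  intro x y hxy
  apply hθi
  change β₁ (Ψe.symm (χ (α x))) = β₁ (Ψe.symm (χ (α y)))
  rw [hxy]

section finiteIndex

variable {κ : Type} {M : κ → Type} [∀ k, Group (M k)]

/-- `s` is a final segment of the reduced form of `g`. -/
def IsSuffix (s g : CoprodI M) : Prop :=
  ∃ p, g = p * s ∧ (fstIdx p⁻¹ ≠ fstIdx s ∨ p = 1 ∧ s = 1)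

lemma fstIdx_mul_of {q : CoprodI M} {k : κ} {m : M k} (hq : q ≠ 1) (h : q * of m ≠ 1) :
    fstIdx (q * of m) = fstIdx q := by
  obtain ⟨a, r, hr, hrk⟩ := exists_of_mul k q⁻¹
  have hq' : q = r⁻¹ * of a⁻¹ := by
    rw [← inv_inv q, hr, mul_inv_rev, map_inv]
  by_cases h1 : r = 1
  · subst h1
    rw [inv_one, one_mul] at hq'
    subst hq'
    rw [← map_mul] at h ⊢
    rw [fstIdx_of, fstIdx_of]
    · rintro h'
      exact hq (by rw [h', map_one])
    · rintro h'
      exact h (by rw [h', map_one])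
  · have key : ∀ z : M k, fstIdx (r⁻¹ * of z) = fstIdx r⁻¹ := by
      intro z
      refine fstIdx_mul (inv_ne_one.2 h1) ?_
      rw [inv_inv]
      by_cases hz : z = 1
      · rw [hz, map_one, fstIdx_one]
        exact fun h => h1 (fstIdx_eq_none.1 h)
      · rwa [fstIdx_of hz]
    rw [hq', mul_assoc, ← map_mul, key, key]

lemma IsSuffix.of_mul {k : κ} {m : M k} {s g : CoprodI M} (h : IsSuffix s (of m * g)) :
    IsSuffix s g ∨ s = of m * g := by
  obtain ⟨p, hp, hps⟩ := h
  by_cases hp1 : p = 1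
  · exact Or.inr (by rw [hp, hp1, one_mul])
  left
  replace hps : fstIdx p⁻¹ ≠ fstIdx s := hps.resolve_right fun h => hp1 h.1
  have hg : g = (of m)⁻¹ * p * s := by
    rw [mul_assoc, ← hp, inv_mul_cancel_left]
  by_cases hp2 : (of m)⁻¹ * p = 1
  · rw [hp2] at hg
    by_cases hs : s = 1
    · exact ⟨1, hg, Or.inr ⟨rfl, hs⟩⟩
    · refine ⟨1, hg, Or.inl ?_⟩
      rw [inv_one, fstIdx_one]
      exact fun h => hs (fstIdx_eq_none.1 h.symm)
  · refine ⟨_, hg, Or.inl ?_⟩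
    have e : ((of m)⁻¹ * p)⁻¹ = p⁻¹ * of m := by group
    have hp3 : p⁻¹ * of m ≠ 1 := by
      rw [← e]
      exact inv_ne_one.2 hp2
    rw [e, fstIdx_mul_of (inv_ne_one.2 hp1) hp3]
    exact hps

lemma exists_finite_isSuffix_mul (w : CoprodI M) :
    ∃ P : Set (CoprodI M), P.Finite ∧
      ∀ g s, IsSuffix s (w * g) → IsSuffix s g ∨ ∃ p ∈ P, s = p * g := by
  induction w using CoprodI.induction_on with
  | one => exact ⟨∅, Set.finite_empty, fun g s h => Or.inl (by rwa [one_mul] at h)⟩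
  | of k m =>
    exact ⟨{of m}, Set.finite_singleton _, fun g s h => h.of_mul.imp id fun h => ⟨_, rfl, h⟩⟩
  | mul x y hx hy =>
    obtain ⟨P, hP, h1⟩ := hx
    obtain ⟨R, hR, h2⟩ := hy
    refine ⟨R ∪ (· * y) '' P, hR.union (hP.image _), fun g s h => ?_⟩
    rw [mul_assoc] at h
    rcases h1 _ _ h with h | ⟨p, hp, rfl⟩
    · rcases h2 _ _ h with h | ⟨p, hp, rfl⟩
      · exact Or.inl h
      · exact Or.inr ⟨p, Or.inl hp, rfl⟩
    · exact Or.inr ⟨_, Or.inr ⟨p, hp, rfl⟩, (mul_assoc _ _ _).symm⟩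

lemma finite_suffixes {C : Type} [Finite C] (t : C → CoprodI M) (N : Subgroup (CoprodI M))
    (ht : Subgroup.closure (Set.range t) = N) :
    {q : CoprodI M ⧸ N | ∃ n ∈ N, ∃ s : CoprodI M, IsSuffix s n ∧ s = q}.Finite := by
  choose P hP hPs using exists_finite_isSuffix_mul (M := M)
  let R : Set (CoprodI M) := {1} ∪ ⋃ c, (P (t c) ∪ P (t c)⁻¹)
  have hR : R.Finite := (Set.finite_singleton _).union
    (Set.finite_iUnion fun c => (hP _).union (hP _))
  refine (hR.image (QuotientGroup.mk (s := N))).subset ?_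
  rintro _ ⟨n, hn, s, hs, rfl⟩
  suffices ∃ p ∈ R, p⁻¹ * s ∈ N by
    obtain ⟨p, hp, h⟩ := this
    exact ⟨p, hp, QuotientGroup.eq.2 h⟩
  rw [← ht] at hn
  induction hn using Subgroup.closure_induction_left generalizing s with
  | one =>
    refine ⟨1, Or.inl rfl, ?_⟩
    obtain ⟨p, hp, h⟩ := hs
    have hps : p⁻¹ = s := inv_eq_of_mul_eq_one_right hp.symm
    rcases h with h | h
    · exact absurd (congrArg fstIdx hps) h
    · rw [h.2, inv_one, one_mul]
      exact one_mem _
  | mul_left x hx y hy ih =>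
    obtain ⟨c, rfl⟩ := hx
    rcases hPs _ _ _ hs with h | ⟨p, hp, rfl⟩
    · exact ih _ h
    · exact ⟨p, Or.inr (Set.mem_iUnion.2 ⟨c, Or.inl hp⟩), by
        rwa [inv_mul_cancel_left, ← ht]⟩
  | inv_mul_cancel x hx y hy ih =>
    obtain ⟨c, rfl⟩ := hx
    rcases hPs _ _ _ hs with h | ⟨p, hp, rfl⟩
    · exact ih _ h
    · exact ⟨p, Or.inr (Set.mem_iUnion.2 ⟨c, Or.inr hp⟩), by
        rwa [inv_mul_cancel_left, ← ht]⟩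

lemma exists_mem_fstIdx_of_fstIdx {N : Subgroup (CoprodI M)} [N.Normal] {n : CoprodI M}
    (hn : n ∈ N) (hn1 : n ≠ 1) {k : κ} (h1 : fstIdx n ≠ some k) (h2 : fstIdx n⁻¹ ≠ some k)
    [Nontrivial (M k)] :
    ∃ n ∈ N, fstIdx n = some k ∧ fstIdx n⁻¹ = some k := by
  obtain ⟨y, hy⟩ := exists_ne (1 : M k)
  have key : ∀ n : CoprodI M, n ≠ 1 → fstIdx n ≠ some k → fstIdx n⁻¹ ≠ some k →
      fstIdx (of y * n * (of y)⁻¹) = some k := by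
    intro n hn1 h1 h2
    rw [mul_assoc, fstIdx_mul (of_ne_one hy), fstIdx_of hy]
    rw [← map_inv, fstIdx_of (inv_ne_one.2 hy), fstIdx_mul hn1]
    · exact h1.symm
    · rwa [fstIdx_of (inv_ne_one.2 hy)]
  refine ⟨of y * n * (of y)⁻¹, Subgroup.Normal.conj_mem inferInstance n hn _, key n hn1 h1 h2, ?_⟩
  have e : (of y * n * (of y)⁻¹)⁻¹ = of y * n⁻¹ * (of y)⁻¹ := by group
  rw [e]
  exact key _ (inv_ne_one.2 hn1) h2 (by rwa [inv_inv])

lemma exists_mem_fstIdx_of_eq_of_ne {N : Subgroup (CoprodI M)} [N.Normal] {n : CoprodI M}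
    (hn : n ∈ N) {k : κ} (hk : ∀ a : M k, ∃ x, x ≠ 1 ∧ x ≠ a)
    (h1 : fstIdx n = some k) (h2 : fstIdx n⁻¹ ≠ some k) :
    ∃ n ∈ N, fstIdx n = some k ∧ fstIdx n⁻¹ = some k := by
  obtain ⟨a, r, rfl, hr⟩ := exists_of_mul k n
  have hr1 : r ≠ 1 := by
    rintro rfl
    rw [mul_one] at h1 h2
    have ha : a ≠ 1 := by
      rintro rfl
      rw [map_one, fstIdx_one] at h1
      exact absurd h1 (by simp)
    rw [← map_inv, fstIdx_of (inv_ne_one.2 ha)] at h2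
    exact h2 rfl
  have ha : a ≠ 1 := by
    rintro rfl
    rw [map_one, one_mul] at h1
    exact hr h1
  have e2 : fstIdx r⁻¹ ≠ some k := by
    rw [mul_inv_rev, fstIdx_mul (inv_ne_one.2 hr1)] at h2
    · exact h2
    · rw [inv_inv, ← map_inv, fstIdx_of (inv_ne_one.2 ha)]
      exact hr
  obtain ⟨x, hx1, hxa⟩ := hk a⁻¹
  have hxa1 : x * a ≠ 1 := fun h => hxa (eq_inv_of_mul_eq_one_left h)
  have e1 : of x * (of a * r) * (of x)⁻¹ = of (x * a) * (r * of x⁻¹) := by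
    rw [map_mul, map_inv]
    group
  have key : ∀ (y z : M k), y ≠ 1 → z ≠ 1 → ∀ r : CoprodI M, r ≠ 1 → fstIdx r ≠ some k →
      fstIdx r⁻¹ ≠ some k → fstIdx (of y * (r * of z)) = some k := by
    intro y z hy hz r hr1 h1 h2
    rw [fstIdx_mul (of_ne_one hy), fstIdx_of hy]
    rw [← map_inv, fstIdx_of (inv_ne_one.2 hy), fstIdx_mul hr1]
    · exact h1.symm
    · rwa [fstIdx_of hz]
  refine ⟨of x * (of a * r) * (of x)⁻¹, Subgroup.Normal.conj_mem inferInstance _ hn _, ?_, ?_⟩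
  · rw [e1]
    exact key _ _ hxa1 (inv_ne_one.2 hx1) _ hr1 hr e2
  · have e3 : (of (x * a) * (r * of x⁻¹))⁻¹ = of x * (r⁻¹ * of (x * a)⁻¹) := by
      rw [map_inv, map_inv]
      group
    rw [e1, e3]
    exact key _ _ hx1 (inv_ne_one.2 hxa1) _ (inv_ne_one.2 hr1) e2 (by rwa [inv_inv])

/-- A nontrivial finitely generated normal subgroup of a free product, other than the infinite
dihedral group, has finite index. -/
theorem finite_quotient [Nontrivial κ] [∀ k, Nontrivial (M k)] {C : Type} [Finite C]
    (t : C → CoprodI M) (N : Subgroup (CoprodI M)) [hN : N.Normal]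
    (ht : Subgroup.closure (Set.range t) = N) (hbot : N ≠ ⊥) (k : κ)
    (hk : ∀ a : M k, ∃ x, x ≠ 1 ∧ x ≠ a) : Finite (CoprodI M ⧸ N) := by
  obtain ⟨n, hn, hn1⟩ : ∃ n ∈ N, n ≠ 1 := by
    by_contra! h
    exact hbot ((Subgroup.eq_bot_iff_forall N).2 h)
  have h1 : ∃ n ∈ N, fstIdx n = some k ∧ fstIdx n⁻¹ = some k := by
    by_cases h1 : fstIdx n = some k <;>
      by_cases h2 : fstIdx n⁻¹ = some k
    · exact ⟨n, hn, h1, h2⟩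
    · exact exists_mem_fstIdx_of_eq_of_ne hn hk h1 h2
    · exact exists_mem_fstIdx_of_eq_of_ne (inv_mem hn) hk h2 (by rwa [inv_inv])
    · exact exists_mem_fstIdx_of_fstIdx hn hn1 h1 h2
  have hne1 : ∀ {g : CoprodI M} {k : κ}, fstIdx g = some k → g ≠ 1 := by
    rintro _ k h rfl
    rw [fstIdx_one] at h
    exact absurd h (by simp)
  have h2 : ∀ j, ∃ n ∈ N, fstIdx n = some j ∧ fstIdx n⁻¹ = some j := by
    intro j
    by_cases hj : j = k
    · rwa [hj]
    · obtain ⟨n, hn, ha, hb⟩ := h1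
      have hjk : some k ≠ some j := fun h => hj (Option.some_injective _ h).symm
      exact exists_mem_fstIdx_of_fstIdx hn (hne1 ha) (by rwa [ha]) (by rwa [hb])
  have h3 : ∀ h : CoprodI M, ∃ n ∈ N, IsSuffix h n := by
    intro h
    by_cases hh : h = 1
    · exact ⟨1, one_mem _, 1, by rw [hh, one_mul], Or.inr ⟨rfl, hh⟩⟩
    obtain ⟨i, hi⟩ := Option.ne_none_iff_exists'.1 fun h' => hh (fstIdx_eq_none.1 h')
    obtain ⟨j, hj⟩ := exists_ne i
    have hji : some j ≠ some i := fun h => hj (Option.some_injective _ h)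
    obtain ⟨n, hn, ha, hb⟩ := h2 j
    refine ⟨h⁻¹ * n * h, ?_, h⁻¹ * n, rfl, Or.inl ?_⟩
    · simpa using hN.conj_mem n hn h⁻¹
    · rw [mul_inv_rev, inv_inv, fstIdx_mul (inv_ne_one.2 (hne1 ha)), hb, hi]
      · exact hji
      · rw [inv_inv, ha, hi]
        exact hji
  have hfin := finite_suffixes t N ht
  refine Set.finite_univ_iff.1 (hfin.subset fun q _ => ?_)
  obtain ⟨h, rfl⟩ := QuotientGroup.mk_surjective q
  obtain ⟨n, hn, hs⟩ := h3 h
  exact ⟨n, hn, h, hs, rfl⟩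

end finiteIndex

end Monoid.CoprodI

section cocycle

variable {G U Q : Type} [Group G] [Group U] [Group Q]

/-- A Schreier-type generating family for the values of a crossed homomorphism. -/
lemma RegularWreathProduct.exists_generators (Θ : G →* U ≀ᵣ Q)
    (hs : Function.Surjective fun g => (Θ g).right) {C : Type} (t : C → G)
    (ht : ∀ g, g ∈ Subgroup.closure (Set.range t) ↔ (Θ g).right = 1) :
    ∃ u : C ⊕ {q : Q // q ≠ 1} → U, ∀ g x, (Θ g).left x ∈ Subgroup.closure (Set.range u) := by
  choose r hr using hs
  simp only at hr
  let u : C ⊕ {q : Q // q ≠ 1} → U :=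
    Sum.elim (fun c => (Θ (t c)).left 1) (fun q => (Θ (r q.1)).left q.1)
  refine ⟨u, ?_⟩
  have hmul : ∀ g h x, (Θ (g * h)).left x = (Θ g).left x * (Θ h).left ((Θ g).right⁻¹ * x) := by
    intro g h x
    rw [map_mul, RegularWreathProduct.mul_left, Pi.mul_apply]
  have hD : ∀ g h, (Θ (g * h)).left (Θ (g * h)).right =
      (Θ g).left (Θ (g * h)).right * (Θ h).left (Θ h).right := by
    intro g h
    rw [hmul]
    congr 2
    rw [map_mul, RegularWreathProduct.mul_right, inv_mul_cancel_left]
  let D : Subgroup G :=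
    { carrier := {n | (Θ n).right = 1 ∧ (Θ n).left 1 ∈ Subgroup.closure (Set.range u)}
      one_mem' := by
        constructor
        · rw [map_one, RegularWreathProduct.one_right]
        · rw [map_one, RegularWreathProduct.one_left]
          exact one_mem _
      mul_mem' := by
        rintro a b ⟨ha, ha'⟩ ⟨hb, hb'⟩
        refine ⟨by rw [map_mul, RegularWreathProduct.mul_right, ha, hb, mul_one], ?_⟩
        rw [hmul, ha, inv_one, one_mul]
        exact mul_mem ha' hb'
      inv_mem' := by
        rintro a ⟨ha, ha'⟩
        refine ⟨by rw [map_inv, RegularWreathProduct.inv_right, ha, inv_one], ?_⟩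
        rw [map_inv, RegularWreathProduct.inv_left]
        change ((Θ a).left ((Θ a).right * 1))⁻¹ ∈ _
        rw [ha, one_mul]
        exact inv_mem ha' }
  have hN : ∀ n, (Θ n).right = 1 → (Θ n).left 1 ∈ Subgroup.closure (Set.range u) := by
    intro n hn
    have : Subgroup.closure (Set.range t) ≤ D := by
      rw [Subgroup.closure_le]
      rintro _ ⟨c, rfl⟩
      exact ⟨(ht _).1 (Subgroup.subset_closure ⟨c, rfl⟩),
        Subgroup.subset_closure ⟨Sum.inl c, rfl⟩⟩
    exact (this ((ht n).2 hn)).2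
  have hr' : ∀ q, (Θ (r q)).left q ∈ Subgroup.closure (Set.range u) := by
    intro q
    by_cases hq : q = 1
    · subst hq
      exact hN _ (hr 1)
    · exact Subgroup.subset_closure ⟨Sum.inr ⟨q, hq⟩, rfl⟩
  have hall : ∀ g, (Θ g).left (Θ g).right ∈ Subgroup.closure (Set.range u) := by
    intro g
    have e : g = r (Θ g).right * ((r (Θ g).right)⁻¹ * g) := (mul_inv_cancel_left _ _).symm
    have h1 : (Θ ((r (Θ g).right)⁻¹ * g)).right = 1 := by
      rw [map_mul, RegularWreathProduct.mul_right, map_inv, RegularWreathProduct.inv_right, hr,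
        inv_mul_cancel]
    have h2 := hD (r (Θ g).right) ((r (Θ g).right)⁻¹ * g)
    rw [← e, h1] at h2
    rw [h2]
    exact mul_mem (hr' _) (hN _ h1)
  intro g x
  have h := hD g (r ((Θ g).right⁻¹ * x))
  have e : (Θ (g * r ((Θ g).right⁻¹ * x))).right = x := by
    rw [map_mul, RegularWreathProduct.mul_right, hr, mul_inv_cancel_left]
  have h1 := hall (g * r ((Θ g).right⁻¹ * x))
  rw [e] at h h1
  rw [h] at h1
  exact (Subgroup.mul_mem_cancel_right _ (hall _)).1 h1

/-- Representatives of the orbits of a group `A` acting on `Q` through `p : A →* Q`, together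
with elements of `A` carrying the representatives to each point. -/
structure OrbitSection {A : Type} [Group A] (p : A →* Q) where
  /-- The representative of the orbit. -/
  rep : Q → Q
  /-- An element carrying the representative to the given point. -/
  sec : Q → A
  sec_mul_rep : ∀ q, p (sec q) * rep q = q
  rep_mul : ∀ a q, rep (p a * q) = rep q
  sec_of_rep_eq : ∀ q, rep q = q → sec q = 1

variable {A : Type} [Group A] {p : A →* Q}

lemma OrbitSection.rep_rep (S : OrbitSection p) (q : Q) : S.rep (S.rep q) = S.rep q := by
  conv_rhs => rw [← S.sec_mul_rep q, S.rep_mul]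

lemma OrbitSection.nonempty (p : A →* Q) : Nonempty (OrbitSection p) := by
  classical
  let R := QuotientGroup.rightRel p.range
  let rep : Q → Q := fun q => (Quotient.mk R q).out
  have h1 : ∀ q, ∃ a, p a * rep q = q := by
    intro q
    have : R (rep q) q := Quotient.exact (Quotient.out_eq (Quotient.mk R q))
    obtain ⟨a, ha⟩ := QuotientGroup.rightRel_apply.1 this
    exact ⟨a, by rw [ha, inv_mul_cancel_right]⟩
  choose s hs using h1
  refine ⟨⟨rep, fun q => if rep q = q then 1 else s q, fun q => ?_, fun a q => ?_,
    fun q hq => if_pos hq⟩⟩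
  · split_ifs with h
    · rw [map_one, one_mul, h]
    · exact hs q
  · have : Quotient.mk R (p a * q) = Quotient.mk R q := by
      refine Quotient.sound ?_
      change R _ _
      rw [QuotientGroup.rightRel_apply]
      exact ⟨a⁻¹, by rw [map_inv, mul_inv_rev, mul_inv_cancel_left]⟩
    simp only [rep, this]

lemma OrbitSection.card_mul [Finite Q] (S : OrbitSection p) :
    Nat.card {q // S.rep q = q} * Nat.card p.range = Nat.card Q := by
  rw [← Nat.card_prod]
  refine Nat.card_congr
    { toFun := fun x => x.2.1 * x.1.1
      invFun := fun q => (⟨S.rep q, S.rep_rep q⟩, ⟨p (S.sec q), S.sec q, rfl⟩)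
      left_inv := ?_
      right_inv := fun q => S.sec_mul_rep q }
  rintro ⟨⟨q, hq⟩, ⟨_, a, rfl⟩⟩
  have h1 : S.rep (p a * q) = q := (S.rep_mul a q).trans hq
  have h2 := S.sec_mul_rep (p a * q)
  rw [h1] at h2
  simp only [Prod.mk.injEq, Subtype.mk.injEq]
  exact ⟨h1, Subtype.ext (mul_right_cancel h2)⟩

/-- The homomorphism to a wreath product induced from homomorphisms on the stabilizers. -/
def OrbitSection.wreath (S : OrbitSection p) (ν : Q → p.ker →* U) (y : Q → U) : A →* U ≀ᵣ Q where
  toFun a := ⟨fun x => y x * ν (S.rep x) ⟨(S.sec x)⁻¹ * a * S.sec ((p a)⁻¹ * x), by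
    have h1 := S.sec_mul_rep ((p a)⁻¹ * x)
    have h2 := S.rep_mul a⁻¹ x
    rw [map_inv] at h2
    have h3 := S.sec_mul_rep x
    rw [h2] at h1
    rw [MonoidHom.mem_ker, map_mul, map_mul, map_inv, mul_assoc, inv_mul_eq_one]
    rw [← eq_mul_inv_iff_mul_eq] at h1 h3
    rw [h1, h3]
    group⟩ * (y ((p a)⁻¹ * x))⁻¹, p a⟩
  map_one' := by
    ext x
    · simp only [map_one, mul_one, inv_one, one_mul, inv_mul_cancel,
        RegularWreathProduct.one_left, Pi.one_apply]
      rw [show (⟨1, _⟩ : p.ker) = 1 from rfl, map_one, mul_one, mul_inv_cancel]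
    · simp
  map_mul' a b := by
    ext x
    · have h2 := S.rep_mul a⁻¹ x
      rw [map_inv] at h2
      have e : (p (a * b))⁻¹ * x = (p b)⁻¹ * ((p a)⁻¹ * x) := by
        rw [map_mul, mul_inv_rev, mul_assoc]
      simp only [RegularWreathProduct.mul_left, Pi.mul_apply, h2, e]
      have e2 : ∀ (z w : p.ker) (c d f : U), c * ν (S.rep x) z * d⁻¹ * (d * ν (S.rep x) w * f⁻¹)
          = c * ν (S.rep x) (z * w) * f⁻¹ := by
        intro z w c d f
        rw [map_mul]
        group
      rw [e2]
      congr 3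
      ext
      simp only [Subgroup.coe_mul]
      group
    · simp

lemma OrbitSection.wreath_left_sec (S : OrbitSection p) (ν : Q → p.ker →* U) (y : Q → U)
    (hy : ∀ q, S.rep q = q → y q = 1) (x : Q) : (S.wreath ν y (S.sec x)).left x = y x := by
  have h1 : (p (S.sec x))⁻¹ * x = S.rep x := by
    rw [inv_mul_eq_iff_eq_mul, S.sec_mul_rep]
  simp only [wreath, MonoidHom.coe_mk, OneHom.coe_mk, h1, hy _ (S.rep_rep x),
    S.sec_of_rep_eq _ (S.rep_rep x), mul_one, inv_one, inv_mul_cancel]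
  rw [show (⟨1, _⟩ : p.ker) = 1 from rfl, map_one, mul_one]

lemma OrbitSection.wreath_left_ker (S : OrbitSection p) (ν : Q → p.ker →* U) (y : Q → U)
    (hy : ∀ q, S.rep q = q → y q = 1) (x : Q) (hx : S.rep x = x) (a : p.ker) :
    (S.wreath ν y a).left x = ν x a := by
  have h1 : (p a)⁻¹ * x = x := by
    rw [MonoidHom.mem_ker.1 a.2, inv_one, one_mul]
  simp only [wreath, MonoidHom.coe_mk, OneHom.coe_mk, h1, hy _ hx, S.sec_of_rep_eq _ hx, hx]
  simp

end cocycle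

namespace Monoid.CoprodI

section kernel

variable {κ : Type} [Fintype κ] {M : κ → Type} [∀ k, Group (M k)] {Q : Type} [Group Q]

/-- Lower bound for the number of generators of the kernel of a homomorphism from a free product
to a finite group. -/
theorem exists_generators_kernel [Fintype Q] (π : CoprodI M →* Q)
    (hπ : Function.Surjective π) {C : Type} [Fintype C] (t : C → CoprodI M)
    (ht : Subgroup.closure (Set.range t) = π.ker) :
    ∃ (s : ∀ k, Finset (π.comp (of (M := M) (i := k))).ker) (a : κ → ℕ),
      (∀ k, Subgroup.closure (s k : Set (π.comp (of (M := M) (i := k))).ker) = ⊤) ∧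
      (∀ k, a k * Nat.card (π.comp (of (M := M) (i := k))).range = Nat.card Q) ∧
      ∑ k, (a k * (s k).card + (Nat.card Q - a k)) ≤
        Fintype.card C + (Nat.card Q - 1) := by
  have S : ∀ k, OrbitSection (π.comp (of (M := M) (i := k))) :=
    fun k => (OrbitSection.nonempty _).some
  classical
  let I := Σ k, {q // (S k).rep q = q}
  let J := Σ k, {q // (S k).rep q ≠ q}
  let V : I ⊕ J → Type := Sum.elim (fun i => (π.comp (of (M := M) (i := i.1))).ker)
    (fun _ => Multiplicative ℤ)
  let ofl : ∀ i : I, (π.comp (of (M := M) (i := i.1))).ker →* CoprodI V :=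
    fun i => of (M := V) (i := Sum.inl i)
  let ofr : ∀ j : J, Multiplicative ℤ →* CoprodI V := fun j => of (M := V) (i := Sum.inr j)
  let ν : ∀ k, Q → (π.comp (of (M := M) (i := k))).ker →* CoprodI V := fun k q =>
    if h : (S k).rep q = q then ofl ⟨k, q, h⟩ else 1
  let y : κ → Q → CoprodI V := fun k q =>
    if h : (S k).rep q = q then 1 else ofr ⟨k, q, h⟩ (Multiplicative.ofAdd 1)
  have hy : ∀ k q, (S k).rep q = q → y k q = 1 := fun k q h => dif_pos h
  let Θ : CoprodI M →* CoprodI V ≀ᵣ Q := lift fun k => (S k).wreath (ν k) (y k)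
  have hΘ : ∀ g, (Θ g).right = π g := by
    have : RegularWreathProduct.rightHom.comp Θ = π := by
      refine CoprodI.ext_hom _ _ fun k => ?_
      ext a
      simp only [MonoidHom.comp_apply, Θ, lift_of]
      rfl
    exact fun g => DFunLike.congr_fun this g
  obtain ⟨u, hu⟩ := RegularWreathProduct.exists_generators Θ (by simpa only [hΘ] using hπ) t
    (fun g => by rw [ht, hΘ, MonoidHom.mem_ker])
  have hV : Subgroup.closure (Set.range u) = ⊤ := by
    refine eq_top_of_forall_of_mem ?_
    rintro (⟨k, q, hq⟩ | ⟨k, q, hq⟩) x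
    · have h := hu (of (show (π.comp (of (M := M) (i := k))).ker from x).1) q
      rw [lift_of, (S k).wreath_left_ker _ _ (hy k) q hq] at h
      simp only [ν, dif_pos hq] at h
      exact h
    · have h := hu (of ((S k).sec q)) q
      rw [lift_of, (S k).wreath_left_sec _ _ (hy k) q] at h
      simp only [y, dif_neg hq] at h
      have h2 := Subgroup.zpow_mem _ h (Multiplicative.toAdd (show Multiplicative ℤ from x))
      rw [← map_zpow, ← ofAdd_zsmul, smul_eq_mul, mul_one, ofAdd_toAdd] at h2
      exact h2
  have hcard : Fintype.card (C ⊕ {q : Q // q ≠ 1}) = Fintype.card C + (Nat.card Q - 1) := by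
    rw [Fintype.card_sum, Fintype.card_subtype_compl, Fintype.card_subtype_eq,
      Nat.card_eq_fintype_card]
  rw [← hcard]
  rcases isEmpty_or_nonempty κ with hκ | hκ
  · exact ⟨fun k => hκ.elim k, fun k => hκ.elim k, fun k => hκ.elim k, fun k => hκ.elim k, by simp⟩
  have hne : ∀ k, Nonempty {q // (S k).rep q = q} := fun k => ⟨(S k).rep 1, (S k).rep_rep 1⟩
  have hIJ : Nonempty (I ⊕ J) := by
    obtain ⟨k⟩ := hκ
    exact ⟨Sum.inl ⟨k, (hne k).some⟩⟩
  obtain ⟨s, hs, hc⟩ := exists_generators_factors (U := V) u hV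
  choose q hq using fun k => Finite.exists_min
    fun q : {q // (S k).rep q = q} => (s (Sum.inl ⟨k, q⟩)).card
  refine ⟨fun k => s (Sum.inl ⟨k, q k⟩), fun k => Nat.card {q // (S k).rep q = q},
    fun k => hs (Sum.inl ⟨k, q k⟩), fun k => (S k).card_mul, le_trans ?_ hc⟩
  rw [Fintype.sum_sum_type, Finset.sum_add_distrib]
  refine add_le_add ?_ ?_
  · rw [Fintype.sum_sigma]
    refine Finset.sum_le_sum fun k _ => ?_
    change Nat.card {q // (S k).rep q = q} * (s (Sum.inl ⟨k, q k⟩)).card ≤ _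
    rw [Nat.card_eq_fintype_card, ← smul_eq_mul, ← Finset.card_univ, ← Finset.sum_const]
    exact Finset.sum_le_sum fun q' _ => hq k q'
  · have h1 : ∀ j : J, 1 ≤ (s (Sum.inr j)).card := by
      intro j
      by_contra hlt
      have h0 : s (Sum.inr j) = ∅ := Finset.card_eq_zero.1 (by omega)
      have h := hs (Sum.inr j)
      rw [h0, Finset.coe_empty, Subgroup.closure_empty] at h
      have : Nontrivial (V (Sum.inr j)) := inferInstanceAs (Nontrivial (Multiplicative ℤ))
      exact bot_ne_top h
    calc ∑ k, (Nat.card Q - Nat.card {q // (S k).rep q = q}) = Fintype.card J := by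
          rw [Fintype.card_sigma]
          refine Finset.sum_congr rfl fun k _ => ?_
          rw [Fintype.card_subtype_compl, Nat.card_eq_fintype_card, Nat.card_eq_fintype_card]
      _ = ∑ _j : J, 1 := Fintype.card_eq_sum_ones
      _ ≤ _ := Finset.sum_le_sum fun j _ => h1 j

end kernel

end Monoid.CoprodI

/-- A group is generated by at most as many elements as the kernel and the image of a
homomorphism together. -/
lemma exists_finset_closure_eq_top {A Q : Type} [Group A] [Group Q] (p : A →* Q)
    (s : Finset p.ker) (hs : Subgroup.closure (s : Set p.ker) = ⊤)
    (r : Finset p.range) (hr : Subgroup.closure (r : Set p.range) = ⊤) :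
    ∃ v : Finset A, Subgroup.closure (v : Set A) = ⊤ ∧ v.card ≤ s.card + r.card := by
  classical
  choose f hf using p.rangeRestrict_surjective
  refine ⟨s.image p.ker.subtype ∪ r.image f, ?_, (Finset.card_union_le _ _).trans
    (add_le_add Finset.card_image_le Finset.card_image_le)⟩
  set K := Subgroup.closure ((s.image p.ker.subtype ∪ r.image f : Finset A) : Set A) with hK
  have h1 : p.ker ≤ K := by
    have : (⊤ : Subgroup p.ker) ≤ K.comap p.ker.subtype := by
      rw [← hs, Subgroup.closure_le]
      intro x hx
      exact Subgroup.subset_closure (by simp; exact Or.inl hx)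
    intro x hx
    exact this (Subgroup.mem_top (⟨x, hx⟩ : p.ker))
  have h2 : (⊤ : Subgroup p.range) ≤ K.map p.rangeRestrict := by
    rw [← hr, Subgroup.closure_le]
    intro x hx
    exact ⟨f x, Subgroup.subset_closure (by
      rw [Finset.coe_union, Finset.coe_image, Finset.coe_image]
      exact Or.inr ⟨x, hx, rfl⟩), hf x⟩
  rw [eq_top_iff]
  rintro x -
  obtain ⟨z, hz, hzx⟩ := h2 (Subgroup.mem_top (p.rangeRestrict x))
  have hzx' : p z = p x := congrArg Subtype.val hzx
  have h3 : z⁻¹ * x ∈ K := h1 (by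
    rw [MonoidHom.mem_ker, map_mul, map_inv, hzx', inv_mul_cancel])
  have := K.mul_mem hz h3
  rwa [mul_inv_cancel_left] at this

/-- A finite group of order `n` is generated by at most `log₂ n` elements. -/
lemma exists_finset_two_pow_card_le (H : Type) [Group H] [Finite H] :
    ∃ s : Finset H, Subgroup.closure (s : Set H) = ⊤ ∧ 2 ^ s.card ≤ Nat.card H := by
  classical
  have hne : ({s | 2 ^ s.card ≤ Nat.card (Subgroup.closure (s : Set H))} :
      Set (Finset H)).Nonempty := ⟨∅, by simp⟩
  obtain ⟨s, hs, hmax⟩ := Set.exists_max_image _ Finset.card (Set.toFinite _) hne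
  have htop : Subgroup.closure (s : Set H) = ⊤ := by
    by_contra htop
    obtain ⟨x, -, hx⟩ := SetLike.exists_of_lt (lt_top_iff_ne_top.2 htop)
    have hxs : x ∉ s := fun h => hx (Subgroup.subset_closure h)
    have hle : Subgroup.closure (s : Set H) ≤ Subgroup.closure (insert x s : Finset H) :=
      Subgroup.closure_mono (by simp)
    have hlt : Nat.card (Subgroup.closure (s : Set H)) <
        Nat.card (Subgroup.closure ((insert x s : Finset H) : Set H)) := by
      refine lt_of_le_of_ne (Subgroup.card_le_of_le hle) fun h => hx ?_
      rw [Subgroup.eq_of_le_of_card_ge hle h.ge]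
      exact Subgroup.subset_closure (by simp)
    have h2 := hmax (insert x s) (by
      rw [Set.mem_ofPred_eq, Finset.card_insert_of_notMem hxs, pow_succ]
      obtain ⟨c, hc⟩ := Subgroup.card_dvd_of_le hle
      rw [hc] at hlt ⊢
      refine Nat.mul_le_mul hs ?_
      by_contra hc2
      interval_cases c <;> omega)
    rw [Finset.card_insert_of_notMem hxs] at h2
    omega
  refine ⟨s, htop, ?_⟩
  have := hs
  rwa [Set.mem_ofPred_eq, htop, Subgroup.card_top] at this

lemma false_of_rank_bound {k k₁ k₂ a₁ a₂ d₁ d₂ e₁ e₂ n₁ n₂ : ℕ} (hk : 9 ≤ k)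
    (h₁ : a₁ * k₁ = k) (h₂ : a₂ * k₂ = k) (he₁ : 2 ^ e₁ ≤ k₁) (he₂ : 2 ^ e₂ ≤ k₂)
    (hn₁ : n₁ ≤ d₁ + e₁) (hn₂ : n₂ ≤ d₂ + e₂) (hd₁ : d₁ = 0 → 4 ≤ k₁) (hd₂ : d₂ = 0 → 2 ≤ k₂)
    (h : a₁ * d₁ + (k - a₁) + (a₂ * d₂ + (k - a₂)) ≤ n₁ + n₂ + (k - 1)) : False := by
  have key : ∀ e : ℕ, 8 * e ≤ 2 ^ e + 16 := by
    intro e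
    rcases lt_or_ge e 4 with h | h
    · interval_cases e <;> norm_num
    · induction e, h using Nat.le_induction with
      | base => norm_num
      | succ e h ih =>
        rw [pow_succ]
        have : 2 ^ 4 ≤ 2 ^ e := Nat.pow_le_pow_right (by norm_num) h
        omega
  have ha₁ : 1 ≤ a₁ := Nat.one_le_iff_ne_zero.2 (by rintro rfl; omega)
  have ha₂ : 1 ≤ a₂ := Nat.one_le_iff_ne_zero.2 (by rintro rfl; omega)
  have hk₁ : k₁ ≤ k := by nlinarith
  have hk₂ : k₂ ≤ k := by nlinarith
  have hak₁ : a₁ ≤ k := by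
    have : 1 ≤ k₁ := Nat.one_le_iff_ne_zero.2 (by rintro rfl; omega)
    nlinarith
  have hak₂ : a₂ ≤ k := by
    have : 1 ≤ k₂ := Nat.one_le_iff_ne_zero.2 (by rintro rfl; omega)
    nlinarith
  have hb₁ := key e₁
  have hb₂ := key e₂
  have hsmall : ∀ {e : ℕ}, 2 ^ e < 4 → e ≤ 1 := by
    intro e h
    by_contra hlt
    have : 2 ^ 2 ≤ 2 ^ e := Nat.pow_le_pow_right (by norm_num) (by omega)
    omega
  have hpos : ∀ {a d : ℕ}, 1 ≤ a → 1 ≤ d → a + d ≤ a * d + 1 := by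
    intro a d ha hd
    nlinarith
  rcases Nat.eq_zero_or_pos d₁ with hz₁ | hz₁ <;> rcases Nat.eq_zero_or_pos d₂ with hz₂ | hz₂
  · have h4 := hd₁ hz₁
    have h2 := hd₂ hz₂
    subst hz₁ hz₂
    have hq₁ : 4 * a₁ ≤ k := by nlinarith
    rcases Nat.lt_or_ge k₂ 4 with hlt | hge
    · have := hsmall (he₂.trans_lt hlt)
      interval_cases k₂
      · rcases Nat.lt_or_ge a₁ 3 with hlt' | hge'
        · interval_cases a₁ <;> omega
        · have : 3 * (k₁ - 2) ≤ a₁ * (k₁ - 2) := Nat.mul_le_mul_right _ hge'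
          rw [Nat.mul_sub a₁] at this
          omega
      · omega
    · have hq₂ : 4 * a₂ ≤ k := by nlinarith
      have : k ≤ 12 := by omega
      have : a₁ ≤ 3 := by omega
      have : a₂ ≤ 3 := by omega
      have hlog : ∀ {e : ℕ}, 2 ^ e ≤ 12 → e ≤ 3 := by
        intro e h
        by_contra hlt
        have : 2 ^ 4 ≤ 2 ^ e := Nat.pow_le_pow_right (by norm_num) (by omega)
        omega
      have := hlog (he₁.trans (by omega))
      have := hlog (he₂.trans (by omega))
      interval_cases a₁ <;> interval_cases a₂ <;> omega
  · have h4 := hd₁ hz₁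
    have := hpos ha₂ hz₂
    subst hz₁
    have hq₁ : 4 * a₁ ≤ k := by nlinarith
    omega
  · have h2 := hd₂ hz₂
    have := hpos ha₁ hz₁
    subst hz₂
    rcases Nat.lt_or_ge k₂ 4 with hlt | hge
    · have := hsmall (he₂.trans_lt hlt)
      interval_cases k₂ <;> omega
    · have hq₂ : 4 * a₂ ≤ k := by nlinarith
      omega
  · have := hpos ha₁ hz₁
    have := hpos ha₂ hz₂
    omega

lemma nine_le_card_of_commutator_eq_top (Q : Type) [Group Q] [Finite Q] [Nontrivial Q]
    (h : commutator Q = ⊤) : 9 ≤ Nat.card Q := by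
  by_contra! hlt
  have hns : ¬ Group.IsSolvable Q := fun hs =>
    (Group.IsSolvable.commutator_lt_top_of_nontrivial (G := Q)).ne h
  have h1 : 1 < Nat.card Q := Finite.one_lt_card
  have hp : ∀ {p n : ℕ}, p.Prime → Nat.card Q ≠ p ^ n := by
    intro p n hp hc
    have := Fact.mk hp
    have := (IsPGroup.of_card hc).isNilpotent
    exact hns inferInstance
  have hsq : ¬ Squarefree (Nat.card Q) := fun hs => by
    have := IsZGroup.of_squarefree hs
    exact hns inferInstance
  have h6 : Nat.card Q ≠ 6 := by
    intro h
    rw [h] at hsq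
    exact hsq (by decide +kernel)
  have h2 := hp (n := 1) Nat.prime_two
  have h22 := hp (n := 2) Nat.prime_two
  have h23 := hp (n := 3) Nat.prime_two
  have h3 := hp (n := 1) Nat.prime_three
  have h5 := hp (n := 1) Nat.prime_five
  have h7 := hp (n := 1) Nat.prime_seven
  omega

lemma commutator_eq_top_of_surjective {G H : Type} [Group G] [Group H] (f : G →* H)
    (hf : Function.Surjective f) (h : commutator G = ⊤) : commutator H = ⊤ := by
  rw [← Subgroup.map_top_of_surjective f hf, commutator_def, ← Subgroup.map_top_of_surjective f hf,
    ← Subgroup.map_commutator, ← commutator_def, h]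

lemma PerfectlyHopfian.of_mulEquiv {G H : Type} [Group G] [Group H] (e : G ≃* H)
    (hG : PerfectlyHopfian G) : PerfectlyHopfian H := by
  intro φ hn hc
  let ψ : G →* G := (e.symm.toMonoidHom.comp φ).comp e.toMonoidHom
  have hr : φ.range.map e.symm.toMonoidHom = ψ.range := by
    ext x
    constructor
    · rintro ⟨_, ⟨y, rfl⟩, rfl⟩
      exact ⟨e.symm y, by simp [ψ]⟩
    · rintro ⟨y, rfl⟩
      exact ⟨φ (e y), ⟨_, rfl⟩, rfl⟩
  have hψ : ψ.range.Normal := hr ▸ hn.map _ e.symm.surjective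
  have hb : Function.Bijective ψ := hG ψ hψ (commutator_eq_top_of_surjective
    (QuotientGroup.congr φ.range ψ.range e.symm hr).toMonoidHom (MulEquiv.surjective _) hc)
  have : φ = (e.toMonoidHom.comp ψ).comp e.symm.toMonoidHom := by
    ext x
    simp [ψ]
  rw [this]
  exact (e.bijective.comp hb).comp e.symm.bijective

lemma PerfectlyHopfian.injective_of_surjective {G : Type} [Group G] (hG : PerfectlyHopfian G)
    (f : G →* G) (hf : Function.Surjective f) : Function.Injective f := by
  have hr : f.range = ⊤ := MonoidHom.range_eq_top.2 hf
  have hn : f.range.Normal := hr ▸ inferInstance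
  have : Subsingleton (G ⧸ f.range) := by
    rw [hr]
    exact QuotientGroup.subsingleton_quotient_top
  exact (hG f hn (Subsingleton.elim _ _)).1

lemma PerfectlyHopfian.commutator_ne_top {G : Type} [Group G] [Nontrivial G]
    (hG : PerfectlyHopfian G) : commutator G ≠ ⊤ := by
  intro h
  have hn : (1 : G →* G).range.Normal := by
    rw [MonoidHom.range_one]
    infer_instance
  obtain ⟨x, hx⟩ := exists_ne (1 : G)
  exact hx ((hG 1 hn (commutator_eq_top_of_surjective (QuotientGroup.mk' _)
    (QuotientGroup.mk'_surjective _) h)).1 rfl)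

/-- The image of an injective homomorphism from a noncyclic group to a finite group has at least
four elements. -/
lemma four_le_card_range {A Q : Type} [Group A] [Group Q] [Finite Q] (hA : ¬ IsCyclic A)
    (p : A →* Q) (hp : p.ker = ⊥) : 4 ≤ Nat.card p.range := by
  have e := p.ofInjective ((MonoidHom.ker_eq_bot_iff p).1 hp)
  have hnc : ¬ IsCyclic p.range := fun h => hA (isCyclic_of_surjective e.symm e.symm.surjective)
  by_contra! hlt
  have h0 : Nat.card p.range ≠ 0 := Nat.card_pos.ne'
  have hpr : ∀ {q : ℕ}, q.Prime → Nat.card p.range ≠ q := fun hq h => by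
    have := Fact.mk hq
    exact hnc (isCyclic_of_prime_card h)
  have h1 : Nat.card p.range ≠ 1 := fun h => by
    have := (Nat.card_eq_one_iff_unique.1 h).1
    exact hnc inferInstance
  have h2 := hpr Nat.prime_two
  have h3 := hpr Nat.prime_three
  omega

lemma ker_eq_bot_of_card_eq_zero {A Q : Type} [Group A] [Group Q] {p : A →* Q}
    {s : Finset p.ker} (hs : Subgroup.closure (s : Set p.ker) = ⊤) (h0 : s.card = 0) :
    p.ker = ⊥ := by
  rw [Finset.card_eq_zero.1 h0, Finset.coe_empty, Subgroup.closure_empty] at hs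
  refine (Subgroup.eq_bot_iff_forall _).2 fun x hx => ?_
  have h : (⟨x, hx⟩ : p.ker) ∈ (⊥ : Subgroup p.ker) := hs ▸ Subgroup.mem_top _
  exact congrArg Subtype.val (Subgroup.mem_bot.1 h)

namespace Monoid.CoprodI

/-- The free product of a noncyclic group and a nontrivial group, both perfectly-Hopfian and
finitely generated, is perfectly-Hopfian. -/
theorem perfectlyHopfian (M : Bool → Type) [∀ b, Group (M b)] [∀ b, Nontrivial (M b)]
    [∀ b, Group.FG (M b)] (hp : ∀ b, PerfectlyHopfian (M b)) (hnc : ¬ IsCyclic (M true)) :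
    PerfectlyHopfian (CoprodI M) := by
  intro φ hn hperf
  choose S hS hS' using fun b => Group.rank_spec (M b)
  let t : (Σ b, {x // x ∈ S b}) → CoprodI M := fun x => of x.2.1
  have ht : Subgroup.closure (Set.range t) = ⊤ := by
    refine eq_top_of_forall_of_mem fun b x => ?_
    have : (⊤ : Subgroup (M b)) ≤ (Subgroup.closure (Set.range t)).comap of := by
      rw [← hS' b, Subgroup.closure_le]
      exact fun x hx => Subgroup.subset_closure ⟨⟨b, x, hx⟩, rfl⟩
    exact this (Subgroup.mem_top x)
  have htN : Subgroup.closure (Set.range (φ ∘ t)) = φ.range := by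
    rw [Set.range_comp, ← MonoidHom.map_closure, ht, MonoidHom.range_eq_map]
  have hker : (QuotientGroup.mk' φ.range).ker = φ.range := QuotientGroup.ker_mk' _
  by_cases hbot : φ.range = ⊥
  · exfalso
    refine (hp true).commutator_ne_top (commutator_eq_top_of_surjective
      (QuotientGroup.lift φ.range (retract true) fun x hx => ?_) ?_ hperf)
    · rw [hbot, Subgroup.mem_bot] at hx
      exact hx ▸ one_mem _
    · exact fun x => ⟨QuotientGroup.mk (of x), retract_of_same x⟩
  have hfin : Finite (CoprodI M ⧸ φ.range) := by
    refine finite_quotient (φ ∘ t) φ.range htN hbot true fun a => ?_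
    by_contra! h
    refine hnc ⟨a, fun x => ?_⟩
    change x ∈ Subgroup.zpowers a
    by_cases hx : x = 1
    · exact hx ▸ one_mem _
    · exact h x hx ▸ Subgroup.mem_zpowers _
  rcases subsingleton_or_nontrivial (CoprodI M ⧸ φ.range) with hsub | hnt
  · have hs : Function.Surjective φ := by
      rw [← MonoidHom.range_eq_top]
      exact QuotientGroup.subsingleton_iff.1 hsub
    exact ⟨injective_of_surjective t ht (fun b => (hp b).injective_of_surjective) φ hs, hs⟩
  exfalso
  have h9 := nine_le_card_of_commutator_eq_top _ hperf
  have := Fintype.ofFinite (CoprodI M ⧸ φ.range)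
  obtain ⟨s, a, hs, ha, hsum⟩ := exists_generators_kernel (QuotientGroup.mk' φ.range)
    (QuotientGroup.mk'_surjective _) (φ ∘ t) (htN.trans hker.symm)
  choose r hr hr' using fun b => exists_finset_two_pow_card_le
    ((QuotientGroup.mk' φ.range).comp (of (M := M) (i := b))).range
  have hrank : ∀ b, Group.rank (M b) ≤ (s b).card + (r b).card := by
    intro b
    obtain ⟨v, hv, hvc⟩ := exists_finset_closure_eq_top _ (s b) (hs b) (r b) (hr b)
    exact (Group.rank_le hv).trans hvc
  have hC : Fintype.card (Σ b, {x // x ∈ S b}) = Group.rank (M true) + Group.rank (M false) := by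
    rw [Fintype.card_sigma, Fintype.sum_bool, Fintype.card_coe, Fintype.card_coe, hS, hS]
  rw [hC, Fintype.sum_bool] at hsum
  refine false_of_rank_bound h9 (ha true) (ha false) (hr' true) (hr' false) (hrank true)
    (hrank false) (fun h0 => four_le_card_range hnc _ (ker_eq_bot_of_card_eq_zero (hs true) h0))
    (fun h0 => ?_) hsum
  have e := MonoidHom.ofInjective
    ((MonoidHom.ker_eq_bot_iff _).1 (ker_eq_bot_of_card_eq_zero (hs false) h0))
  have : Nontrivial ((QuotientGroup.mk' φ.range).comp (of (M := M) (i := false))).range :=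
    e.symm.surjective.nontrivial
  exact Finite.one_lt_card

end Monoid.CoprodI

/-- The family consisting of two groups. -/
def boolFamily (G₁ G₂ : Type) (b : Bool) : Type := if b then G₁ else G₂

instance boolFamilyGroup (G₁ G₂ : Type) [Group G₁] [Group G₂] : ∀ b, Group (boolFamily G₁ G₂ b)
  | true => inferInstanceAs (Group G₁)
  | false => inferInstanceAs (Group G₂)

/-- The binary free product as a free product of a family. -/
def coprodIBoolFamilyEquiv (G₁ G₂ : Type) [Group G₁] [Group G₂] :
    Monoid.CoprodI (boolFamily G₁ G₂) ≃* Monoid.Coprod G₁ G₂ :=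
  MonoidHom.toMulEquiv
    (Monoid.CoprodI.lift (M := boolFamily G₁ G₂) fun b => match b with
      | true => (Monoid.Coprod.inl : G₁ →* Monoid.Coprod G₁ G₂)
      | false => (Monoid.Coprod.inr : G₂ →* Monoid.Coprod G₁ G₂))
    (Monoid.Coprod.lift (Monoid.CoprodI.of (M := boolFamily G₁ G₂) (i := true))
      (Monoid.CoprodI.of (M := boolFamily G₁ G₂) (i := false)))
    (by
      refine Monoid.CoprodI.ext_hom _ _ fun b => ?_
      ext x
      cases b <;> simp only [MonoidHom.comp_apply, Monoid.CoprodI.lift_of, MonoidHom.id_apply]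
      · exact Monoid.Coprod.lift_apply_inr _ _ _
      · exact Monoid.Coprod.lift_apply_inl _ _ _)
    (by
      ext x
      · simp only [MonoidHom.comp_apply, MonoidHom.id_apply]
        exact Monoid.CoprodI.lift_of _ _
      · simp only [MonoidHom.comp_apply, MonoidHom.id_apply]
        exact Monoid.CoprodI.lift_of _ _)

theorem freeProduct_freelyIndecomposable_isPerfectlyHopfian
    (G₁ G₂ : Type) [Group G₁] [Group G₂] [Nontrivial G₁] [Nontrivial G₂]
    [Group.FG G₁] [Group.FG G₂]
    (hf₁ : FreelyIndecomposable G₁) (hf₂ : FreelyIndecomposable G₂)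
    (hp₁ : PerfectlyHopfian G₁) (hp₂ : PerfectlyHopfian G₂)
    (hnc : ¬ IsCyclic G₁) :
    PerfectlyHopfian (Monoid.Coprod G₁ G₂) := by
  have h1 : ∀ b, Nontrivial (boolFamily G₁ G₂ b)
    | true => inferInstanceAs (Nontrivial G₁)
    | false => inferInstanceAs (Nontrivial G₂)
  have h2 : ∀ b, Group.FG (boolFamily G₁ G₂ b)
    | true => inferInstanceAs (Group.FG G₁)
    | false => inferInstanceAs (Group.FG G₂)
  have h3 : ∀ b, PerfectlyHopfian (boolFamily G₁ G₂ b)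
    | true => hp₁
    | false => hp₂
  exact (Monoid.CoprodI.perfectlyHopfian (boolFamily G₁ G₂) h3 hnc).of_mulEquiv
    (coprodIBoolFamilyEquiv G₁ G₂)
end

section
/- Let G₁ and G₂ be perfectly-Hopfian groups such that G₁ is normally incommensurable with G₂. Then the direct product G₁ × G₂ is perfectly-Hopfian. -/
/-- `G` is normally incommensurable with `H` if there is no nontrivial homomorphism
`f : G →* H` with `f(G)` a normal subgroup of some normal subgroup `K` of `H`. -/
def NormallyIncommensurable (G H : Type*) [Group G] [Group H] : Prop :=
  ¬ ∃ (f : G →* H) (K : Subgroup H), f ≠ 1 ∧ K.Normal ∧ f.range ≤ K ∧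
      (f.range.subgroupOf K).Normal

theorem prod_isPerfectlyHopfian (G₁ G₂ : Type*) [Group G₁] [Group G₂]
    (hp₁ : PerfectlyHopfian G₁) (hp₂ : PerfectlyHopfian G₂)
    (hni : NormallyIncommensurable G₁ G₂) :
    PerfectlyHopfian (G₁ × G₂) := by
  intro φ hn hperf
  have : Group.IsPerfect ((G₁ × G₂) ⧸ φ.range) := ⟨hperf⟩
  let f : G₁ →* G₂ := (MonoidHom.snd G₁ G₂).comp (φ.comp (MonoidHom.inl G₁ G₂))
  let a : G₁ →* G₁ := (MonoidHom.fst G₁ G₂).comp (φ.comp (MonoidHom.inl G₁ G₂))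
  let d : G₂ →* G₂ := (MonoidHom.snd G₁ G₂).comp (φ.comp (MonoidHom.inr G₁ G₂))
  have hf : f = 1 := by
    by_contra hf
    refine hni ⟨f, φ.range.map (MonoidHom.snd G₁ G₂), hf, hn.map _ Prod.snd_surjective, ?_, ?_⟩
    · rintro _ ⟨x, rfl⟩
      exact ⟨φ (x, 1), ⟨_, rfl⟩, rfl⟩
    · refine ⟨?_⟩
      rintro ⟨_, _⟩ ⟨x, rfl⟩ ⟨_, _, ⟨⟨u, v⟩, rfl⟩, rfl⟩
      refine ⟨u * x * u⁻¹, ?_⟩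
      have h : ((u * x * u⁻¹, 1) : G₁ × G₂) = (u, v) * (x, 1) * (u, v)⁻¹ := by simp
      change (φ (u * x * u⁻¹, 1)).2 = (φ (u, v)).2 * (φ (x, 1)).2 * (φ (u, v)).2⁻¹
      rw [h, map_mul, map_mul, map_inv]
      rfl
  have hφ₁ (x : G₁) : φ (x, 1) = (a x, 1) := Prod.ext rfl (DFunLike.congr_fun hf x)
  have hφ (x : G₁) (y : G₂) : φ (x, y) = (a x * (φ (1, y)).1, d y) := by
    have h : ((x, y) : G₁ × G₂) = (x, 1) * (1, y) := by simp
    rw [h, map_mul, hφ₁]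
    exact Prod.ext rfl (one_mul _)
  have hd_range : d.range = φ.range.map (MonoidHom.snd G₁ G₂) := by
    ext z
    constructor
    · rintro ⟨y, rfl⟩
      exact ⟨φ (1, y), ⟨_, rfl⟩, rfl⟩
    · rintro ⟨_, ⟨⟨x, y⟩, rfl⟩, rfl⟩
      exact ⟨y, (congrArg Prod.snd (hφ x y) :).symm⟩
  have hd_normal : d.range.Normal := hd_range ▸ hn.map _ Prod.snd_surjective
  have hd : Function.Bijective d := by
    refine hp₂ d hd_normal (Group.IsPerfect.ofSurjective
      (f := QuotientGroup.map φ.range d.range (MonoidHom.snd G₁ G₂)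
        (hd_range ▸ Subgroup.le_comap_map _ _)) ?_).commutator_eq_top
    intro q
    obtain ⟨y, rfl⟩ := QuotientGroup.mk_surjective q
    exact ⟨QuotientGroup.mk (1, y), rfl⟩
  let g : G₁ →* (G₁ × G₂) ⧸ φ.range := (QuotientGroup.mk' φ.range).comp (MonoidHom.inl G₁ G₂)
  have hg : Function.Surjective g := by
    intro q
    obtain ⟨⟨x, y⟩, rfl⟩ := QuotientGroup.mk_surjective q
    obtain ⟨y, rfl⟩ := hd.2 y
    refine ⟨x * (φ (1, y)).1⁻¹, QuotientGroup.eq.2 ?_⟩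
    have hy : (φ (1, y)).2 = d y := rfl
    have h : ((x * (φ (1, y)).1⁻¹, 1) : G₁ × G₂)⁻¹ * (x, d y) =
        φ (1, y) := Prod.ext (by simp) (by simp [hy])
    exact ⟨(1, y), h.symm⟩
  have hg_ker : g.ker = a.range := by
    ext z
    have hz : z ∈ g.ker ↔ (z, (1 : G₂)) ∈ φ.range := QuotientGroup.eq_one_iff _
    rw [hz]
    constructor
    · rintro ⟨⟨x, y⟩, h⟩
      rw [hφ, Prod.mk.injEq] at h
      obtain rfl : y = 1 := hd.1 (h.2.trans (map_one d).symm)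
      exact ⟨x, by simpa [← Prod.one_eq_mk] using h.1⟩
    · rintro ⟨x, rfl⟩
      exact ⟨(x, 1), hφ₁ x⟩
  have ha_normal : a.range.Normal := hg_ker ▸ g.normal_ker
  have ha : Function.Bijective a := by
    let e := (QuotientGroup.quotientMulEquivOfEq hg_ker).symm.trans
      (QuotientGroup.quotientKerEquivOfSurjective g hg)
    exact hp₁ a ha_normal
      (Group.IsPerfect.ofSurjective (f := e.symm.toMonoidHom) e.symm.surjective).commutator_eq_top
  constructor
  · rw [injective_iff_map_eq_one]
    rintro ⟨x, y⟩ h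
    rw [hφ, Prod.mk_eq_one] at h
    obtain rfl : y = 1 := hd.1 (h.2.trans (map_one d).symm)
    obtain rfl : x = 1 := ha.1 (by simpa [← Prod.one_eq_mk] using h.1)
    rfl
  · rintro ⟨u, v⟩
    obtain ⟨y, rfl⟩ := hd.2 v
    obtain ⟨x, hx⟩ := ha.2 (u * (φ (1, y)).1⁻¹)
    exact ⟨(x, y), by rw [hφ, hx, inv_mul_cancel_right]⟩
end
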